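/- arXiv:2309.13647 — 4 statements merged into one kernel-verified Lean document; each statement's English description precedes it below -/
import Mathlib

section
/- Let 0 < α < 1 be rational and let L be a finite list of rational items, each lying in the interval (0, α]. If s = DNF(L) is the number of bins covered by Dual Next Fit on L, then load(L) < (1 + α)·s + 1, where load(L) is the sum of the entries of L. -/
/-- One step of Dual Next Fit: from state `(s, ℓ)`, reading item `v`,
if `ℓ + v ≥ 1` the current bin is covered and closed, otherwise `v` is
added to the current bin. -/
def dnfStep (st : ℕ × ℚ) (v : ℚ) : ℕ × ℚ :=
  if 1 ≤ st.2 + v then (st.1 + 1, 0) else (st.1, st.2 + v)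

/-- The number of bins covered by Dual Next Fit on the input list `L`. -/
def DNF (L : List ℚ) : ℕ := (L.foldl dnfStep (0, 0)).1

/-- If the open bin of the state `st` is not yet covered and every remaining item is at most `α`,
then the load already packed plus the load to come is bounded by the final number of covered
bins. -/
theorem add_sum_lt_foldl_dnfStep {α : ℚ} {L : List ℚ} (hL : ∀ v ∈ L, v ≤ α)
    (st : ℕ × ℚ) (hst : st.2 < 1) :
    (1 + α) * (st.1 : ℚ) + st.2 + L.sum < (1 + α) * ((L.foldl dnfStep st).1 : ℚ) + 1 := by
  induction L generalizing st with
  | nil => simpa using hst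
  | cons v L ih =>
    have hv : v ≤ α := hL v (by simp)
    have ih := ih fun w hw => hL w (by simp [hw])
    simp only [List.sum_cons, List.foldl_cons]
    by_cases h : 1 ≤ st.2 + v
    · have hclosed := ih (st.1 + 1, 0) (by norm_num)
      simp only [dnfStep, if_pos h]
      push_cast at hclosed
      linarith
    · have hopen := ih (st.1, st.2 + v) (not_le.mp h)
      simp only [dnfStep, if_neg h]
      linarith

/-- If every item of `L` lies in `(0, α]` with `0 < α < 1`, then
`load L < (1 + α) · DNF L + 1`. -/
theorem load_lt_dnf (α : ℚ) (hα0 : 0 < α) (hα1 : α < 1)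
    (L : List ℚ) (hL : ∀ v ∈ L, 0 < v ∧ v ≤ α) :
    L.sum < (1 + α) * (DNF L : ℚ) + 1 := by
  simpa [DNF] using add_sum_lt_foldl_dnfStep (fun v hv => (hL v hv).2) (0, 0) (by norm_num)
end

section
/- Let 0 < α < 1 be rational and let L be a finite list of rational items, each lying in the interval (0, α]. Then for every partition of the multiset of entries of L into bins, if N denotes the number of bins whose sum is at least 1, one has DNF(L) > N/(1 + α) − 1/(1 + α). In particular, DNF(L) > OPT(L)/(1 + α) − 1/(1 + α), where OPT(L) is the maximum number of covered bins over all partitions of the multiset of entries of L. -/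
/-- The number of covered bins in a partition of a multiset of rationals. -/
def coveredCount (P : Multiset (Multiset ℚ)) : ℕ :=
  (P.filter fun B => 1 ≤ B.sum).card

/-- Starting from a bin of level below `1`, the level already collected plus the remaining
items is less than `(1 + α)` times the final number of covered bins, plus `1`. -/
theorem dnf_foldl_bound {α : ℚ} (L : List ℚ) (hL : ∀ v ∈ L, v ≤ α) (st : ℕ × ℚ)
    (hst : st.2 < 1) :
    (st.1 : ℚ) * (1 + α) + st.2 + L.sum < ((L.foldl dnfStep st).1 : ℚ) * (1 + α) + 1 := by
  induction L generalizing st with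
  | nil => simpa using hst
  | cons v L ih =>
    have hv : v ≤ α := hL v (by simp)
    have ih' := ih (fun w hw => hL w (by simp [hw])) (dnfStep st v)
    rw [List.foldl_cons, List.sum_cons]
    by_cases h : 1 ≤ st.2 + v
    · have hstep : dnfStep st v = (st.1 + 1, 0) := if_pos h
      rw [hstep] at ih' ⊢
      have := ih' zero_lt_one
      push_cast at this
      linarith
    · have hstep : dnfStep st v = (st.1, st.2 + v) := if_neg h
      rw [hstep] at ih' ⊢
      have := ih' (not_le.mp h)
      dsimp only at this
      linarith

/-- The number of covered bins is at most the total size of the items. -/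
theorem coveredCount_le_sum (P : Multiset (Multiset ℚ)) (hP : ∀ v ∈ P.sum, 0 ≤ v) :
    (coveredCount P : ℚ) ≤ P.sum.sum := by
  induction P using Multiset.induction_on with
  | empty => simp [coveredCount]
  | cons B P ih =>
    rw [Multiset.sum_cons] at hP ⊢
    have hB : 0 ≤ B.sum :=
      Multiset.sum_nonneg fun v hv => hP v (Multiset.mem_add.mpr (Or.inl hv))
    have ih' := ih fun v hv => hP v (Multiset.mem_add.mpr (Or.inr hv))
    rw [Multiset.sum_add]
    unfold coveredCount at ih' ⊢
    by_cases h : 1 ≤ B.sum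
    · rw [Multiset.filter_cons_of_pos (p := fun B : Multiset ℚ => 1 ≤ B.sum) _ h,
        Multiset.card_cons]
      push_cast
      linarith
    · rw [Multiset.filter_cons_of_neg (p := fun B : Multiset ℚ => 1 ≤ B.sum) _ h]
      linarith

/-- If every item of `L` lies in `(0, α]` with `0 < α < 1`, then for every
partition of the multiset of entries of `L` into bins, if `N` is the number of
covered bins, then `DNF L > N/(1 + α) − 1/(1 + α)`.  In particular
`DNF L > OPT L/(1 + α) − 1/(1 + α)`. -/
theorem dnf_gt_opt (α : ℚ) (hα0 : 0 < α) (hα1 : α < 1)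
    (L : List ℚ) (hL : ∀ v ∈ L, 0 < v ∧ v ≤ α)
    (P : Multiset (Multiset ℚ)) (hP : P.sum = ↑L) :
    (coveredCount P : ℚ) / (1 + α) - 1 / (1 + α) < (DNF L : ℚ) := by
  have hcount : (coveredCount P : ℚ) ≤ L.sum := by
    have h := coveredCount_le_sum P fun v hv => by
      rw [hP, Multiset.mem_coe] at hv
      exact (hL v hv).1.le
    rwa [hP, Multiset.sum_coe] at h
  have hbound := dnf_foldl_bound L (fun v hv => (hL v hv).2) (0, 0) zero_lt_one
  rw [← sub_div, div_lt_iff₀ (by linarith)]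
  unfold DNF
  push_cast at hbound
  linarith
end

section
/- For every finite list σ of rational items, each in the open interval (0, 1), there exist a natural number m (with m at most the length of σ) and a rational x with 1/2 ≤ x ≤ 1 such that the strategy DH₂ with advice parameters (m, x) covers at least (3/5)·OPT(σ) − 19/15 bins when serving σ, where OPT(σ) is the maximum number of covered bins over all partitions of the multiset of items of σ. -/
/-- State of the `DH k` advice strategy. -/
structure DHState where
  /-- critical bins: (contains an item of size ≥ x, actual load, virtual load) -/
  crit : List (Bool × ℚ × ℚ)
  /-- the load of the active `t`-bin, for each type `t` -/
  bins : ℕ → ℚ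
  /-- the load of the active small bin -/
  small : ℚ
  /-- the number of closed covered bins -/
  count : ℕ

/-- Update the first element of a list satisfying `p` using `f`. -/
def updateFirst {α : Type*} (p : α → Bool) (f : α → α) : List α → List α
  | [] => []
  | a :: rest => if p a then f a :: rest else a :: updateFirst p f rest

/-- One step of the `DH k` strategy with advice threshold `x` on reading item `v`:
(1) if `v ≥ x` and some critical bin does not yet contain an item of size `≥ x`,
place `v` in the lowest-indexed such critical bin (actual load increases by `v`,
virtual load by `v − x`); (2) otherwise, if `1/k ≤ v`, add `v` to the active bin
of its type `t = ⌈1/v⌉` (where `1/t ≤ v < 1/(t-1)`), closing it as covered when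
its load reaches `1`; (3) if `v < 1/k` and some critical bin has virtual load
`< 1`, place `v` in the lowest-indexed such critical bin (both loads increase by
`v`); otherwise add `v` to the active small bin, closing it as covered when its
load reaches `1`. -/
def dhStep (k : ℕ) (x : ℚ) (st : DHState) (v : ℚ) : DHState :=
  if x ≤ v ∧ (st.crit.any fun c => !c.1) then
    { st with crit := updateFirst (fun c => !c.1)
                  (fun c => (true, c.2.1 + v, c.2.2 + (v - x))) st.crit }
  else if (1 : ℚ) / k ≤ v then
    let t : ℕ := ⌈(1 : ℚ) / v⌉.toNat
    if 1 ≤ st.bins t + v then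
      { st with bins := Function.update st.bins t 0, count := st.count + 1 }
    else
      { st with bins := Function.update st.bins t (st.bins t + v) }
  else if st.crit.any fun c => decide (c.2.2 < 1) then
    { st with crit := updateFirst (fun c => decide (c.2.2 < 1))
                  (fun c => (c.1, c.2.1 + v, c.2.2 + v)) st.crit }
  else if 1 ≤ st.small + v then
    { st with small := 0, count := st.count + 1 }
  else
    { st with small := st.small + v }

/-- The number of bins covered by the strategy `DH k` with advice `(m, x)` on the
input list `σ`: it starts with `m` critical bins (actual load `0`, virtual load
`x`, containing no item of size `≥ x`), empty active `t`-bins and small bin and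
count `0`, processes `σ`, and finally counts the closed covered bins together
with the critical bins whose actual load is at least `1`. -/
def DH (k m : ℕ) (x : ℚ) (σ : List ℚ) : ℕ :=
  let st := σ.foldl (dhStep k x)
    ⟨List.replicate m (false, (0 : ℚ), x), fun _ => 0, 0, 0⟩
  st.count + st.crit.countP fun c => decide (1 ≤ c.2.1)

/-- If some element satisfies `p`, then `updateFirst p f` modifies exactly one such element. -/
theorem exists_updateFirst_eq {α : Type*} (p : α → Bool) (f : α → α) (l : List α)
    (h : l.any p = true) :
    ∃ l₁ a l₂, l = l₁ ++ a :: l₂ ∧ p a = true ∧ updateFirst p f l = l₁ ++ f a :: l₂ := by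
  induction l with
  | nil => simp at h
  | cons b t ih =>
    by_cases hb : p b = true
    · exact ⟨[], b, t, by simp, hb, by simp [updateFirst, hb]⟩
    · have ht : t.any p = true := by
        simpa [hb] using h
      obtain ⟨l₁, a, l₂, h1, h2, h3⟩ := ih ht
      exact ⟨b :: l₁, a, l₂, by simp [h1], h2, by simp [updateFirst, hb, h3]⟩

/-- The indicator of a decidable proposition, as a rational number. -/
abbrev ratIndicator (p : Prop) [Decidable p] : ℚ := if p then 1 else 0

/-- The weight of an item, counting only small items. -/
abbrev smallWeight (w : ℚ → ℚ) (v : ℚ) : ℚ := if v < 1 / 2 then w v else 0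

/-- An upper bound for the weight of the small items in a critical bin of virtual load `y`. -/
abbrev critBound (x d y : ℚ) : ℚ := if y < 1 then y - x else 1 - x + d

/-- The facts about the state of `DH 2` with advice `(m, x)` that hold after serving `τ`. -/
structure DHInvariant (m : ℕ) (x : ℚ) (τ : List ℚ) (st : DHState) : Prop where
  length : st.crit.length = m
  actual : ∀ c ∈ st.crit, c.2.1 = if c.1 then c.2.2 else c.2.2 - x
  flags : (∃ c ∈ st.crit, c.1 = false) →
    (τ.map fun v => ratIndicator (x ≤ v)).sum ≤ (st.crit.map fun c => ratIndicator (c.1 = true)).sum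
  small_nonneg : 0 ≤ st.small
  small_lt : st.small < 1
  counts : ∃ p q : ℕ, st.count = p + q ∧
    (∃ e : ℚ, (e = 0 ∧ st.bins 2 = 0 ∨ e = 1 ∧ 1 / 2 ≤ st.bins 2) ∧
      (τ.map fun v => ratIndicator (1 / 2 ≤ v)).sum ≤
        (st.crit.map fun c => ratIndicator (c.1 = true)).sum + 2 * p + e) ∧
    ((∃ c ∈ st.crit, c.2.2 < 1) → q = 0 ∧ st.small = 0) ∧
    ∀ (w : ℚ → ℚ) (d : ℚ), 0 ≤ d → (∀ v, v < 1 / 2 → w v ≤ v ∧ w v ≤ d) →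
      (τ.map (smallWeight w)).sum ≤
        (st.crit.map fun c => critBound x d c.2.2).sum + 3 / 2 * q + st.small

theorem DHInvariant.initial (m : ℕ) (x : ℚ) (hx : x < 1) :
    DHInvariant m x [] ⟨List.replicate m (false, (0 : ℚ), x), fun _ => 0, 0, 0⟩ where
  length := by simp
  actual := by
    intro c hc
    have := List.eq_of_mem_replicate hc
    subst this
    simp
  flags := by simp
  small_nonneg := le_refl _
  small_lt := by norm_num
  counts := ⟨0, 0, by simp, ⟨0, Or.inl ⟨rfl, rfl⟩, by simp⟩, by simp, by simp [hx]⟩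

/-- Placing an item of size at least `x` in a critical bin preserves the invariant. -/
theorem DHInvariant.place_critical {m : ℕ} {x : ℚ} {τ : List ℚ} {st : DHState}
    (h : DHInvariant m x τ st) (hx : 1 / 2 ≤ x) {v : ℚ} (hv : x ≤ v)
    (ha : (st.crit.any fun c => !c.1) = true) :
    DHInvariant m x (τ ++ [v])
      { st with crit := updateFirst (fun c => !c.1)
                    (fun c => (true, c.2.1 + v, c.2.2 + (v - x))) st.crit } := by
  obtain ⟨l₁, ⟨b, y, z⟩, l₂, h1, h2, h3⟩ := exists_updateFirst_eq (fun c => !c.1)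
    (fun c : Bool × ℚ × ℚ => (true, c.2.1 + v, c.2.2 + (v - x))) st.crit ha
  obtain ⟨crit, bins, small, count⟩ := st
  obtain ⟨hl, hact, hf, hs0, hs1, p, q, hc, ⟨e, he, hbig⟩, hq, hw⟩ := h
  simp only at h1 h2 h3 hl hact hf hs0 hs1 hc he hbig hq hw ⊢
  rw [h3]
  subst h1
  have hb : b = false := by simpa using h2
  subst hb
  have hv2 : 1 / 2 ≤ v := hx.trans hv
  refine ⟨by simpa using hl, ?_, ?_, hs0, hs1, p, q, hc, ⟨e, he, ?_⟩, ?_, ?_⟩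
  · intro c hc
    rcases List.mem_append.1 hc with hc | hc
    · exact hact c (by simp [hc])
    rcases List.mem_cons.1 hc with rfl | hc
    · have := hact (false, y, z) (by simp)
      simp only [Bool.false_eq_true, if_false] at this
      simp only [if_true]
      linarith
    · exact hact c (by simp [hc])
  · intro _
    have := hf ⟨(false, y, z), by simp, rfl⟩
    simp [hv] at this ⊢
    linarith
  · have h5 : ratIndicator (1 / 2 ≤ v) = 1 := if_pos hv2
    have h6 : ratIndicator (false = true) = 0 := if_neg (by simp)
    have h7 : ratIndicator True = 1 := if_pos trivial
    simp only [List.map_append, List.sum_append, List.map_cons, List.sum_cons, List.map_nil,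
      List.sum_nil] at hbig ⊢
    linarith
  · rintro ⟨c, hc, hc1⟩
    apply hq
    rcases List.mem_append.1 hc with hc | hc
    · exact ⟨c, by simp [hc], hc1⟩
    rcases List.mem_cons.1 hc with rfl | hc
    · exact ⟨(false, y, z), by simp, by simp only at hc1 ⊢; linarith⟩
    · exact ⟨c, by simp [hc], hc1⟩
  · intro w d hd hwd
    have h0 := hw w d hd hwd
    have hv3 : ¬ v < 1 / 2 := not_lt.2 hv2
    have h4 : critBound x d z ≤ critBound x d (z + (v - x)) := by
      unfold critBound
      split_ifs <;> linarith
    simp only [List.map_append, List.sum_append, List.map_cons, List.sum_cons, List.map_nil,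
      List.sum_nil] at h0 ⊢
    have h5 : smallWeight w v = 0 := by simp only [smallWeight, if_neg hv3]
    linarith

/-- Placing a small item in a critical bin preserves the invariant. -/
theorem DHInvariant.fill_critical {m : ℕ} {x : ℚ} {τ : List ℚ} {st : DHState}
    (h : DHInvariant m x τ st) (hx : 1 / 2 ≤ x) {v : ℚ} (hv : v < 1 / 2)
    (ha : (st.crit.any fun c => decide (c.2.2 < 1)) = true) :
    DHInvariant m x (τ ++ [v])
      { st with crit := updateFirst (fun c => decide (c.2.2 < 1))
                    (fun c => (c.1, c.2.1 + v, c.2.2 + v)) st.crit } := by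
  obtain ⟨l₁, ⟨b, y, z⟩, l₂, h1, h2, h3⟩ := exists_updateFirst_eq (fun c => decide (c.2.2 < 1))
    (fun c : Bool × ℚ × ℚ => (c.1, c.2.1 + v, c.2.2 + v)) st.crit ha
  obtain ⟨crit, bins, small, count⟩ := st
  obtain ⟨hl, hact, hf, hs0, hs1, p, q, hc, ⟨e, he, hbig⟩, hq, hw⟩ := h
  simp only at h1 h2 h3 hl hact hf hs0 hs1 hc he hbig hq hw ⊢
  rw [h3]
  subst h1
  have hz : z < 1 := by simpa using h2
  have hvx : ¬ x ≤ v := by linarith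
  have hv2 : ¬ 1 / 2 ≤ v := by linarith
  refine ⟨by simpa using hl, ?_, ?_, hs0, hs1, p, q, hc, ⟨e, he, ?_⟩, ?_, ?_⟩
  · intro c hc
    rcases List.mem_append.1 hc with hc | hc
    · exact hact c (by simp [hc])
    rcases List.mem_cons.1 hc with rfl | hc
    · have := hact (b, y, z) (by simp)
      simp only at this ⊢
      split_ifs at this ⊢ <;> linarith
    · exact hact c (by simp [hc])
  · rintro ⟨c, hc, hc1⟩
    have : ∃ c ∈ l₁ ++ (b, y, z) :: l₂, c.1 = false := by
      rcases List.mem_append.1 hc with hc | hc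
      · exact ⟨c, by simp [hc], hc1⟩
      rcases List.mem_cons.1 hc with rfl | hc
      · exact ⟨(b, y, z), by simp, hc1⟩
      · exact ⟨c, by simp [hc], hc1⟩
    have := hf this
    simp only [List.map_append, List.sum_append, List.map_cons, List.sum_cons, List.map_nil,
      List.sum_nil] at this ⊢
    have h5 : ratIndicator (x ≤ v) = 0 := if_neg hvx
    linarith
  · simp only [List.map_append, List.sum_append, List.map_cons, List.sum_cons, List.map_nil,
      List.sum_nil] at hbig ⊢
    have h5 : ratIndicator (1 / 2 ≤ v) = 0 := if_neg hv2
    linarith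
  · intro _
    exact hq ⟨(b, y, z), by simp, hz⟩
  · intro w d hd hwd
    have h0 := hw w d hd hwd
    obtain ⟨hw1, hw2⟩ := hwd v hv
    have h4 : critBound x d z + w v ≤ critBound x d (z + v) := by
      unfold critBound
      split_ifs <;> linarith
    simp only [List.map_append, List.sum_append, List.map_cons, List.sum_cons, List.map_nil,
      List.sum_nil] at h0 ⊢
    have h5 : smallWeight w v = w v := if_pos hv
    linarith

theorem toNat_ceil_one_div_eq_two {v : ℚ} (h : 1 / 2 ≤ v) (h1 : v < 1) :
    ⌈(1 : ℚ) / v⌉.toNat = 2 := by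
  have hv : 0 < v := by linarith
  have : ⌈(1 : ℚ) / v⌉ = 2 := by
    rw [Int.ceil_eq_iff]
    constructor
    · rw [lt_div_iff₀ hv]
      push_cast
      linarith
    · rw [div_le_iff₀ hv]
      push_cast
      linarith
  rw [this]
  rfl

/-- Every step of `DH 2` preserves the invariant. -/
theorem DHInvariant.step {m : ℕ} {x : ℚ} {τ : List ℚ} {st : DHState}
    (h : DHInvariant m x τ st) (hx : 1 / 2 ≤ x) {v : ℚ} (hv0 : 0 < v) (hv1 : v < 1) :
    DHInvariant m x (τ ++ [v]) (dhStep 2 x st v) := by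
  unfold dhStep
  split_ifs with hA hB hC hD
  · exact h.place_critical hx hA.1 hA.2
  · have hB' : 1 / 2 ≤ v := by simpa using hB
    rw [toNat_ceil_one_div_eq_two hB' hv1]
    obtain ⟨crit, bins, small, count⟩ := st
    obtain ⟨hl, hact, hf, hs0, hs1, p, q, hc, ⟨e, he, hbig⟩, hq, hw⟩ := h
    simp only at hA hl hact hf hs0 hs1 hc he hbig hq hw ⊢
    have hbv : ratIndicator (1 / 2 ≤ v) = 1 := if_pos hB'
    have hf' : (∃ c ∈ crit, c.1 = false) →
        ((τ ++ [v]).map fun v => ratIndicator (x ≤ v)).sum ≤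
          (crit.map fun c => ratIndicator (c.1 = true)).sum := by
      rintro ⟨c, hc, hc1⟩
      have hvx : ¬ x ≤ v := fun hxv =>
        hA ⟨hxv, List.any_eq_true.2 ⟨c, hc, by simp [hc1]⟩⟩
      have h5 : ratIndicator (x ≤ v) = 0 := if_neg hvx
      have := hf ⟨c, hc, hc1⟩
      simp only [List.map_append, List.sum_append, List.map_cons, List.sum_cons, List.map_nil,
        List.sum_nil]
      linarith
    have hw' : ∀ (w : ℚ → ℚ) (d : ℚ), 0 ≤ d → (∀ v, v < 1 / 2 → w v ≤ v ∧ w v ≤ d) →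
        ((τ ++ [v]).map (smallWeight w)).sum ≤
          (crit.map fun c => critBound x d c.2.2).sum + 3 / 2 * q + small := by
      intro w d hd hwd
      have h0 := hw w d hd hwd
      have h5 : smallWeight w v = 0 := if_neg (not_lt.2 hB')
      simp only [List.map_append, List.sum_append, List.map_cons, List.sum_cons, List.map_nil,
        List.sum_nil]
      linarith
    split_ifs with hE
    · refine ⟨hl, hact, hf', hs0, hs1, p + 1, q, by simp only; omega,
        ⟨0, Or.inl ⟨rfl, by simp⟩, ?_⟩, hq, hw'⟩
      simp only [List.map_append, List.sum_append, List.map_cons, List.sum_cons, List.map_nil,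
        List.sum_nil]
      push_cast
      rcases he with ⟨he, h2⟩ | ⟨he, h2⟩ <;> linarith
    · refine ⟨hl, hact, hf', hs0, hs1, p, q, hc,
        ⟨1, Or.inr ⟨rfl, ?_⟩, ?_⟩, hq, hw'⟩
      · simp only [Function.update_self]
        rcases he with ⟨he, h2⟩ | ⟨he, h2⟩ <;> linarith
      · simp only [List.map_append, List.sum_append, List.map_cons, List.sum_cons, List.map_nil,
          List.sum_nil]
        rcases he with ⟨he, h2⟩ | ⟨he, h2⟩ <;> linarith
  · exact h.fill_critical hx (by simpa using hB) hC
  all_goals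
    have hB' : v < 1 / 2 := by simpa using hB
    obtain ⟨crit, bins, small, count⟩ := st
    obtain ⟨hl, hact, hf, hs0, hs1, p, q, hc, ⟨e, he, hbig⟩, hq, hw⟩ := h
    simp only at hC hD hA hl hact hf hs0 hs1 hc he hbig hq hw ⊢
    have h5 : ratIndicator (1 / 2 ≤ v) = 0 := if_neg (not_le.2 hB')
    have h6 : ratIndicator (x ≤ v) = 0 := if_neg (by linarith)
    have hfull : ¬ ∃ c ∈ crit, c.2.2 < 1 := by
      rintro ⟨c, hc, hc1⟩
      exact hC (List.any_eq_true.2 ⟨c, hc, by simpa using hc1⟩)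
  · refine ⟨hl, hact, ?_, le_refl _, by norm_num, p, q + 1, by simp only; omega,
      ⟨e, he, ?_⟩, fun hex => absurd hex hfull, ?_⟩
    · simpa only [List.map_append, List.sum_append, List.map_cons, List.sum_cons, List.map_nil,
        List.sum_nil, h6, add_zero] using hf
    · simpa only [List.map_append, List.sum_append, List.map_cons, List.sum_cons, List.map_nil,
        List.sum_nil, h5, add_zero] using hbig
    · intro w d hd hwd
      have h0 := hw w d hd hwd
      have h7 : smallWeight w v = w v := if_pos hB'
      have h8 := (hwd v hB').1
      simp only [List.map_append, List.sum_append, List.map_cons, List.sum_cons, List.map_nil,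
        List.sum_nil]
      push_cast
      linarith
  · refine ⟨hl, hact, ?_, by simp only; linarith, by simp only; linarith, p, q, hc,
      ⟨e, he, ?_⟩, fun hex => absurd hex hfull, ?_⟩
    · simpa only [List.map_append, List.sum_append, List.map_cons, List.sum_cons, List.map_nil,
        List.sum_nil, h6, add_zero] using hf
    · simpa only [List.map_append, List.sum_append, List.map_cons, List.sum_cons, List.map_nil,
        List.sum_nil, h5, add_zero] using hbig
    · intro w d hd hwd
      have h0 := hw w d hd hwd
      have h7 : smallWeight w v = w v := if_pos hB'
      have h8 := (hwd v hB').1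
      simp only [List.map_append, List.sum_append, List.map_cons, List.sum_cons, List.map_nil,
        List.sum_nil]
      linarith

/-- The final state of `DH 2` with advice `(m, x)` on `σ`. -/
def dhFinal (m : ℕ) (x : ℚ) (σ : List ℚ) : DHState :=
  σ.foldl (dhStep 2 x) ⟨List.replicate m (false, (0 : ℚ), x), fun _ => 0, 0, 0⟩

theorem DHInvariant.final (m : ℕ) {x : ℚ} (hx : 1 / 2 ≤ x) (hx1 : x < 1) (σ : List ℚ)
    (hσ : ∀ v ∈ σ, 0 < v ∧ v < 1) : DHInvariant m x σ (dhFinal m x σ) := by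
  induction σ using List.reverseRecOn with
  | nil => exact DHInvariant.initial m x hx1
  | append_singleton l v ih =>
    have h := ih fun u hu => hσ u (by simp [hu])
    obtain ⟨h0, h1⟩ := hσ v (by simp)
    have := h.step hx h0 h1
    simpa [dhFinal, List.foldl_append] using this

theorem List.sum_ratIndicator_le_length {α : Type*} (p : α → Prop) [DecidablePred p]
    (l : List α) : (l.map fun a => ratIndicator (p a)).sum ≤ l.length := by
  induction l with
  | nil => simp
  | cons a t ih =>
    simp only [List.map_cons, List.sum_cons, List.length_cons, Nat.cast_add, Nat.cast_one]
    unfold ratIndicator at ih ⊢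
    split_ifs <;> linarith

theorem sum_critBound_le (x d : ℚ) (hd : 0 ≤ d) (l : List (Bool × ℚ × ℚ)) :
    (l.map fun c => critBound x d c.2.2).sum ≤ l.length * (1 - x + d) := by
  induction l with
  | nil => simp
  | cons a t ih =>
    simp only [List.map_cons, List.sum_cons, List.length_cons, Nat.cast_add, Nat.cast_one]
    have : critBound x d a.2.2 ≤ 1 - x + d := by
      unfold critBound
      split_ifs <;> linarith
    linarith

/-- The performance of `DH 2` when all critical bins end up virtually full. -/
theorem dh_of_full {m : ℕ} {x : ℚ} {σ : List ℚ} (hx : 1 / 2 ≤ x) (hx1 : x < 1)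
    (hσ : ∀ v ∈ σ, 0 < v ∧ v < 1)
    (hm : (m : ℚ) ≤ (σ.map fun v => ratIndicator (x ≤ v)).sum)
    (hfull : ∀ c ∈ (dhFinal m x σ).crit, 1 ≤ c.2.2) :
    ∃ p q : ℕ, (DH 2 m x σ : ℚ) = m + p + q ∧
      (σ.map fun v => ratIndicator (1 / 2 ≤ v)).sum ≤ m + 2 * p + 1 ∧
      (σ.map (smallWeight id)).sum ≤ m * (1 - x + 1 / 2) + 3 / 2 * q + 1 := by
  obtain ⟨hl, hact, hf, hs0, hs1, p, q, hc, ⟨e, he, hbig⟩, hq, hw⟩ :=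
    DHInvariant.final m hx hx1 σ hσ
  have hlenle := List.sum_ratIndicator_le_length (fun c : Bool × ℚ × ℚ => c.1 = true)
    (dhFinal m x σ).crit
  have hflag : ∀ c ∈ (dhFinal m x σ).crit, c.1 = true := by
    intro c hc
    by_contra hcf
    have h1 := hf ⟨c, hc, by simpa using hcf⟩
    obtain ⟨l₁, l₂, hs⟩ := List.append_of_mem hc
    have hz : ratIndicator (c.1 = true) = 0 := if_neg hcf
    have e1 := List.sum_ratIndicator_le_length (fun c : Bool × ℚ × ℚ => c.1 = true) l₁
    have e2 := List.sum_ratIndicator_le_length (fun c : Bool × ℚ × ℚ => c.1 = true) l₂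
    have hl' : (m : ℚ) = l₁.length + l₂.length + 1 := by
      rw [← hl, hs]
      push_cast [List.length_append, List.length_cons]
      ring
    rw [hs] at h1
    simp only [List.map_append, List.sum_append, List.map_cons, List.sum_cons] at h1
    linarith
  refine ⟨p, q, ?_, ?_, ?_⟩
  · have hcount : (dhFinal m x σ).crit.countP (fun c => decide (1 ≤ c.2.1)) = m := by
      refine (List.countP_eq_length.2 ?_).trans hl
      intro c hc
      have := hact c hc
      rw [if_pos (hflag c hc)] at this
      simpa [this] using hfull c hc
    have : DH 2 m x σ = (dhFinal m x σ).count +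
        (dhFinal m x σ).crit.countP (fun c => decide (1 ≤ c.2.1)) := rfl
    rw [this, hcount, hc]
    push_cast
    ring
  · rw [hl] at hlenle
    rcases he with ⟨he, h2⟩ | ⟨he, h2⟩ <;> linarith
  · have h1 := hw id (1 / 2) (by norm_num) fun v hv => ⟨le_refl _, hv.le⟩
    have h2 := sum_critBound_le x (1 / 2) (by norm_num) (dhFinal m x σ).crit
    rw [hl] at h2
    linarith

/-- If some critical bin does not end up virtually full, then the small items have little
total weight. -/
theorem sum_smallWeight_lt_of_not_full {k : ℕ} {x : ℚ} {σ : List ℚ} (hx : 1 / 2 ≤ x)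
    (hx1 : x < 1) (hσ : ∀ v ∈ σ, 0 < v ∧ v < 1)
    (hfull : ¬ ∀ c ∈ (dhFinal (k + 1) x σ).crit, 1 ≤ c.2.2) (w : ℚ → ℚ) (d : ℚ) (hd : 0 ≤ d)
    (hwd : ∀ v, v < 1 / 2 → w v ≤ v ∧ w v ≤ d) :
    (σ.map (smallWeight w)).sum < k * (1 - x + d) + (1 - x) := by
  obtain ⟨hl, hact, hf, hs0, hs1, p, q, hc, ⟨e, he, hbig⟩, hq, hw⟩ :=
    DHInvariant.final (k + 1) hx hx1 σ hσ
  push Not at hfull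
  obtain ⟨hq0, hsm⟩ := hq hfull
  obtain ⟨c, hc, hc1⟩ := hfull
  have h1 := hw w d hd hwd
  obtain ⟨l₁, l₂, hs⟩ := List.append_of_mem hc
  have hl' : (k : ℚ) = l₁.length + l₂.length := by
    rw [hs] at hl
    simp only [List.length_append, List.length_cons] at hl
    have : k = l₁.length + l₂.length := by omega
    exact_mod_cast this
  have e1 := sum_critBound_le x d hd l₁
  have e2 := sum_critBound_le x d hd l₂
  have e3 : critBound x d c.2.2 < 1 - x := by
    simp only [critBound, if_pos hc1]
    linarith
  rw [hs, hq0, hsm] at h1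
  simp only [List.map_append, List.sum_append, List.map_cons, List.sum_cons, Nat.cast_zero] at h1
  rw [hl', add_mul]
  linarith

theorem Multiset.map_sum_sum {α : Type*} (h : α → ℚ) (P : Multiset (Multiset α)) :
    (P.sum.map h).sum = (P.map fun B => (B.map h).sum).sum := by
  induction P using Multiset.induction_on with
  | empty => simp
  | cons B P ih => simp [ih]

/-- A pointwise lower bound by indicators yields a lower bound for a sum. -/
theorem Multiset.countP_mul_add_le_sum {β : Type*} (P : Multiset β) (p r : β → Prop)
    [DecidablePred p] [DecidablePred r] (a b : ℚ) (g : β → ℚ)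
    (h : ∀ B ∈ P, a * ratIndicator (p B) + b * ratIndicator (r B) ≤ g B) :
    a * P.countP p + b * P.countP r ≤ (P.map g).sum := by
  induction P using Multiset.induction_on with
  | empty => simp
  | cons B P ih =>
    have h1 := h B (by simp)
    have h2 := ih fun C hC => h C (by simp [hC])
    rw [Multiset.countP_cons, Multiset.countP_cons, Multiset.map_cons, Multiset.sum_cons]
    unfold ratIndicator at h1
    push_cast
    linarith

theorem Multiset.sum_ratIndicator_eq_countP {α : Type*} (p : α → Prop) [DecidablePred p]
    (B : Multiset α) : (B.map fun v => ratIndicator (p v)).sum = B.countP p := by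
  induction B using Multiset.induction_on with
  | empty => simp
  | cons v B ih =>
    rw [Multiset.countP_cons, Multiset.map_cons, Multiset.sum_cons, ih]
    push_cast
    ring

theorem Multiset.min_sum_le_sum_min {c : ℚ} (hc : 0 ≤ c) (B : Multiset ℚ)
    (hB : ∀ v ∈ B, 0 ≤ v) : min B.sum c ≤ (B.map fun v => min v c).sum := by
  induction B using Multiset.induction_on with
  | empty => simp [hc]
  | cons v B ih =>
    have h1 := ih fun u hu => hB u (by simp [hu])
    have h2 := hB v (by simp)
    have h3 : 0 ≤ B.sum := Multiset.sum_nonneg fun u hu => hB u (by simp [hu])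
    rw [Multiset.map_cons, Multiset.sum_cons, Multiset.sum_cons]
    rcases min_cases B.sum c with h | h <;> rcases min_cases v c with h' | h' <;>
      rcases min_cases (v + B.sum) c with h'' | h'' <;> linarith

theorem Multiset.two_mul_le_sum_min {c : ℚ} (hc : 0 ≤ c) (hc2 : c ≤ 1 / 2) (B : Multiset ℚ)
    (hB : ∀ v ∈ B, 0 ≤ v ∧ v < 1 / 2) (h1 : 1 ≤ B.sum) :
    2 * c ≤ (B.map fun v => min v c).sum := by
  by_cases h : ∃ v ∈ B, c ≤ v
  · obtain ⟨v, hv, hcv⟩ := h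
    obtain ⟨C, rfl⟩ := Multiset.exists_cons_of_mem hv
    have h2 := Multiset.min_sum_le_sum_min hc C fun u hu => (hB u (by simp [hu])).1
    have h3 := (hB v (by simp)).2
    rw [Multiset.sum_cons] at h1
    rw [Multiset.map_cons, Multiset.sum_cons, min_eq_right hcv]
    rw [min_eq_right (by linarith)] at h2
    linarith
  · push Not at h
    have : (B.map fun v => min v c) = B := by
      conv_rhs => rw [← Multiset.map_id' B]
      exact Multiset.map_congr rfl fun v hv => min_eq_left (h v hv).le
    rw [this]
    linarith

theorem sum_smallWeight_of_forall_lt (w : ℚ → ℚ) (B : Multiset ℚ) (hB : ∀ v ∈ B, v < 1 / 2) :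
    (B.map (smallWeight w)).sum = (B.map w).sum := by
  congr 1
  exact Multiset.map_congr rfl fun v hv => if_pos (hB v hv)

/-- The total size of the items of size at least `1/2` in a bin. -/
def bigLoad (B : Multiset ℚ) : ℚ := (B.filter fun v => 1 / 2 ≤ v).sum

/-- A covered bin with no item of size at least `1/2`. -/
abbrev CoveredZero (B : Multiset ℚ) : Prop := 1 ≤ B.sum ∧ B.countP (fun v => 1 / 2 ≤ v) = 0

/-- A covered bin with exactly one item of size at least `1/2`. -/
abbrev CoveredOne (B : Multiset ℚ) : Prop := 1 ≤ B.sum ∧ B.countP (fun v => 1 / 2 ≤ v) = 1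

/-- A covered bin with at least two items of size at least `1/2`. -/
abbrev CoveredTwo (B : Multiset ℚ) : Prop := 1 ≤ B.sum ∧ 2 ≤ B.countP (fun v => 1 / 2 ≤ v)

theorem exists_cons_of_countP_eq_one {B : Multiset ℚ}
    (h : B.countP (fun v => 1 / 2 ≤ v) = 1) :
    ∃ v C, B = v ::ₘ C ∧ 1 / 2 ≤ v ∧ bigLoad B = v ∧ ∀ u ∈ C, u < 1 / 2 := by
  obtain ⟨v, hv, hv2⟩ := Multiset.countP_pos.1 (by omega : 0 < B.countP (fun v => 1 / 2 ≤ v))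
  obtain ⟨C, rfl⟩ := Multiset.exists_cons_of_mem hv
  rw [Multiset.countP_cons, if_pos hv2] at h
  have h0 : C.countP (fun v => 1 / 2 ≤ v) = 0 := by omega
  have hC : ∀ u ∈ C, ¬ 1 / 2 ≤ u := Multiset.countP_eq_zero.1 h0
  refine ⟨v, C, rfl, hv2, ?_, fun u hu => not_le.1 (hC u hu)⟩
  rw [bigLoad, Multiset.filter_cons_of_pos _ hv2, Multiset.filter_eq_nil.2 hC]
  simp

theorem sum_smallWeight_nonneg {w : ℚ → ℚ} (hw : ∀ v, 0 < v → 0 ≤ w v) {B : Multiset ℚ}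
    (hB : ∀ v ∈ B, 0 < v ∧ v < 1) : 0 ≤ (B.map (smallWeight w)).sum := by
  apply Multiset.sum_nonneg
  intro y hy
  obtain ⟨v, hv, rfl⟩ := Multiset.mem_map.1 hy
  unfold smallWeight
  split_ifs
  · exact hw v (hB v hv).1
  · exact le_refl _

/-- A threshold splitting a finite family of values at a prescribed rank. -/
theorem exists_rank_threshold (L : List ℚ) (hL : ∀ v ∈ L, 1 / 2 ≤ v ∧ v < 1) (M : ℕ)
    (hM : M ≤ L.length) :
    ∃ x : ℚ, 1 / 2 ≤ x ∧ x < 1 ∧ M ≤ L.countP (fun v => decide (x ≤ v)) ∧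
      L.length ≤ M + L.countP (fun v => decide (v ≤ x)) := by
  wlog hs : L.Pairwise (fun a b => b ≤ a) generalizing L
  · have hp := List.mergeSort_perm L (fun a b => decide (b ≤ a))
    have hsort : (L.mergeSort (fun a b => decide (b ≤ a))).Pairwise (fun a b => b ≤ a) := by
      have := List.pairwise_mergeSort (le := fun a b : ℚ => decide (b ≤ a))
        (by intro a b c; simp only [decide_eq_true_eq]; intro h1 h2; exact h2.trans h1)
        (by intro a b; simpa using le_total b a) L
      simpa using this
    have := this (L.mergeSort (fun a b => decide (b ≤ a)))
      (fun v hv => hL v (hp.mem_iff.1 hv)) (by rw [hp.length_eq]; exact hM) hsort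
    simpa only [hp.countP_eq, hp.length_eq] using this
  rcases hM.eq_or_lt with rfl | hlt
  · refine ⟨1 / 2, le_refl _, by norm_num, ?_, by omega⟩
    exact (List.countP_eq_length.2 fun v hv => by simpa using (hL v hv).1).ge
  · have hd : L.drop M = L[M] :: L.drop (M + 1) := List.drop_eq_getElem_cons hlt
    have hsplit : L = L.take M ++ L[M] :: L.drop (M + 1) := by rw [← hd, List.take_append_drop]
    have hmem : L[M] ∈ L := List.getElem_mem hlt
    generalize L[M] = x at *
    obtain ⟨h1, h2, h3⟩ := List.pairwise_append.1 (hsplit ▸ hs)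
    have hlen : (L.take M).length = M := by simp [hM]
    refine ⟨x, (hL x hmem).1, (hL x hmem).2, ?_, ?_⟩
    · rw [hsplit, List.countP_append]
      have : (L.take M).countP (fun v => decide (x ≤ v)) = M := by
        conv_rhs => rw [← hlen]
        exact List.countP_eq_length.2 fun v hv => by simpa using h3 v hv x (by simp)
      omega
    · have : (x :: L.drop (M + 1)).countP (fun v => decide (v ≤ x)) =
          (x :: L.drop (M + 1)).length := by
        refine List.countP_eq_length.2 fun v hv => ?_
        rcases List.mem_cons.1 hv with rfl | hv
        · simp
        · simpa using (List.pairwise_cons.1 h2).1 v hv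
      have hle : L.length = M + (x :: L.drop (M + 1)).length := by
        conv_lhs => rw [hsplit, List.length_append, hlen]
      have hcp : L.countP (fun v => decide (v ≤ x)) = (L.take M).countP (fun v => decide (v ≤ x)) +
          (x :: L.drop (M + 1)).countP (fun v => decide (v ≤ x)) := by
        conv_lhs => rw [hsplit, List.countP_append]
      omega

/-- The structural lower bounds on an item list obtained from one of its coverings. -/
theorem exists_threshold_of_covering (σ : List ℚ) (hσ : ∀ v ∈ σ, 0 < v ∧ v < 1)
    (P : Multiset (Multiset ℚ)) (hP : P.sum = ↑σ) :
    ∃ (N₀ N₁ N₂ M : ℕ) (x : ℚ), coveredCount P ≤ N₀ + N₁ + N₂ ∧ M = N₁ / 2 ∧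
      1 / 2 ≤ x ∧ x < 1 ∧
      (M : ℚ) ≤ (σ.map fun v => ratIndicator (x ≤ v)).sum ∧
      (N₁ : ℚ) + 2 * N₂ ≤ (σ.map fun v => ratIndicator (1 / 2 ≤ v)).sum ∧
      (N₀ : ℚ) + (N₁ - M) * (1 - x) ≤ (σ.map (smallWeight id)).sum ∧
      2 * (1 - x) * N₀ + (N₁ - M) * (1 - x) ≤
        (σ.map (smallWeight fun v => min v (1 - x))).sum := by
  have hmem : ∀ B ∈ P, ∀ v ∈ B, 0 < v ∧ v < 1 := by
    intro B hB v hv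
    apply hσ
    have : v ∈ P.sum := Multiset.mem_of_le (Multiset.le_sum_of_mem hB) hv
    rw [hP] at this
    simpa using this
  have hsum : ∀ h : ℚ → ℚ, (σ.map h).sum = (P.map fun B => (B.map h).sum).sum := by
    intro h
    rw [← Multiset.map_sum_sum, hP]
    simp
  set Q := P.filter CoveredOne with hQ
  obtain ⟨x, hx, hx1, hM1, hM2⟩ := exists_rank_threshold (Q.map bigLoad).toList (by
      intro v hv
      rw [Multiset.mem_toList, Multiset.mem_map] at hv
      obtain ⟨B, hB, rfl⟩ := hv
      rw [hQ, Multiset.mem_filter] at hB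
      obtain ⟨v, C, rfl, hv, hb, -⟩ := exists_cons_of_countP_eq_one hB.2.2
      rw [hb]
      exact ⟨hv, (hmem _ hB.1 v (by simp)).2⟩) (P.countP CoveredOne / 2) (by
      rw [Multiset.length_toList, Multiset.card_map, hQ, ← Multiset.countP_eq_card_filter]
      omega)
  have hconv : ∀ p : ℚ → Prop, ∀ _ : DecidablePred p,
      (Q.map bigLoad).toList.countP (fun v => decide (p v)) =
        P.countP (fun B => p (bigLoad B) ∧ CoveredOne B) := by
    intro p _
    rw [← Multiset.coe_countP, Multiset.coe_toList, Multiset.countP_map, hQ,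
      Multiset.filter_filter, Multiset.countP_eq_card_filter]
  rw [hconv (fun v => x ≤ v)] at hM1
  rw [hconv (fun v => v ≤ x), Multiset.length_toList, Multiset.card_map, hQ,
    ← Multiset.countP_eq_card_filter] at hM2
  set M := P.countP CoveredOne / 2 with hM
  have hc : 0 < 1 - x := by linarith
  have hK : ((P.countP CoveredOne : ℚ) - M) * (1 - x) ≤
      (1 - x) * P.countP (fun B => bigLoad B ≤ x ∧ CoveredOne B) := by
    rw [mul_comm]
    apply mul_le_mul_of_nonneg_left _ hc.le
    have : (P.countP CoveredOne : ℚ) ≤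
        M + P.countP (fun B => bigLoad B ≤ x ∧ CoveredOne B) := by exact_mod_cast hM2
    linarith
  refine ⟨P.countP CoveredZero, P.countP CoveredOne, P.countP CoveredTwo, M, x, ?_, rfl,
    hx, hx1, ?_, ?_, ?_, ?_⟩
  · rw [coveredCount, ← Multiset.countP_eq_card_filter]
    clear * -
    induction P using Multiset.induction_on with
    | empty => simp
    | cons B P ih =>
      simp only [Multiset.countP_cons]
      split_ifs <;> first | omega | (exfalso; simp_all; omega)
  · rw [hsum]
    have := Multiset.countP_mul_add_le_sum P (fun B => x ≤ bigLoad B ∧ CoveredOne B)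
      (fun _ => False) 1 0 (fun B => (B.map fun v => ratIndicator (x ≤ v)).sum) (by
        intro B hB
        rw [Multiset.sum_ratIndicator_eq_countP]
        by_cases h : x ≤ bigLoad B ∧ CoveredOne B
        · obtain ⟨v, C, rfl, hv, hb, -⟩ := exists_cons_of_countP_eq_one h.2.2
          rw [hb] at h
          have : (1 : ℕ) ≤ (v ::ₘ C).countP (fun v => x ≤ v) :=
            Multiset.countP_pos.2 ⟨v, by simp, h.1⟩
          have h1 : (1 : ℚ) ≤ ((v ::ₘ C).countP (fun v => x ≤ v) : ℕ) := by exact_mod_cast this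
          simp only [ratIndicator]
          split_ifs <;> linarith
        · simp [ratIndicator, h])
    have h2 : (M : ℚ) ≤ P.countP (fun B => x ≤ bigLoad B ∧ CoveredOne B) := by
      exact_mod_cast hM1
    linarith
  · rw [hsum]
    have := Multiset.countP_mul_add_le_sum P CoveredOne CoveredTwo 1 2
      (fun B => (B.map fun v => ratIndicator (1 / 2 ≤ v)).sum) (by
        intro B hB
        rw [Multiset.sum_ratIndicator_eq_countP]
        unfold ratIndicator
        split_ifs with h1 h2 h2
        · omega
        · rw [h1.2]; norm_num
        · have : (2 : ℚ) ≤ (B.countP (fun v => 1 / 2 ≤ v) : ℕ) := by exact_mod_cast h2.2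
          linarith
        · simp)
    linarith
  · rw [hsum]
    have := Multiset.countP_mul_add_le_sum P CoveredZero
      (fun B => bigLoad B ≤ x ∧ CoveredOne B) 1 (1 - x)
      (fun B => (B.map (smallWeight id)).sum) (by
        intro B hB
        have hpos := sum_smallWeight_nonneg (w := id) (fun v hv => hv.le) (hmem B hB)
        unfold ratIndicator
        split_ifs with h1 h2 h2
        · omega
        · have := Multiset.countP_eq_zero.1 h1.2
          rw [sum_smallWeight_of_forall_lt _ _ fun v hv => not_le.1 (this v hv), Multiset.map_id]
          linarith [h1.1]
        · obtain ⟨v, C, rfl, hv, hb, hC⟩ := exists_cons_of_countP_eq_one h2.2.2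
          have h3 := h2.2.1
          have h4 := h2.1
          rw [Multiset.sum_cons] at h3
          rw [Multiset.map_cons, Multiset.sum_cons, sum_smallWeight_of_forall_lt _ _ hC,
            Multiset.map_id]
          have h5 : smallWeight id v = 0 := if_neg (not_lt.2 hv)
          linarith
        · linarith)
    linarith
  · rw [hsum]
    have := Multiset.countP_mul_add_le_sum P CoveredZero
      (fun B => bigLoad B ≤ x ∧ CoveredOne B) (2 * (1 - x)) (1 - x)
      (fun B => (B.map (smallWeight fun v => min v (1 - x))).sum) (by
        intro B hB
        have hpos := sum_smallWeight_nonneg (w := fun v => min v (1 - x))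
          (fun v hv => le_min hv.le hc.le) (hmem B hB)
        unfold ratIndicator
        split_ifs with h1 h2 h2
        · omega
        · have h3 := Multiset.countP_eq_zero.1 h1.2
          rw [sum_smallWeight_of_forall_lt _ _ fun v hv => not_le.1 (h3 v hv)]
          have := Multiset.two_mul_le_sum_min hc.le (by linarith) B
            (fun v hv => ⟨(hmem B hB v hv).1.le, not_le.1 (h3 v hv)⟩) h1.1
          linarith
        · obtain ⟨v, C, rfl, hv, hb, hC⟩ := exists_cons_of_countP_eq_one h2.2.2
          have h3 := h2.2.1
          have h4 := h2.1
          rw [Multiset.sum_cons] at h3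
          rw [Multiset.map_cons, Multiset.sum_cons, sum_smallWeight_of_forall_lt _ _ hC]
          have h5 : smallWeight (fun v => min v (1 - x)) v = 0 := if_neg (not_lt.2 hv)
          have h6 := Multiset.min_sum_le_sum_min hc.le C fun u hu =>
            (hmem _ hB u (by simp [hu])).1.le
          rw [min_eq_right (by linarith)] at h6
          linarith
        · linarith)
    linarith

theorem coveredCount_le_length (σ : List ℚ) (P : Multiset (Multiset ℚ)) (hP : P.sum = ↑σ) :
    coveredCount P ≤ σ.length := by
  have : ∀ P : Multiset (Multiset ℚ), coveredCount P ≤ P.sum.card := by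
    intro P
    rw [coveredCount, ← Multiset.countP_eq_card_filter]
    induction P using Multiset.induction_on with
    | empty => simp
    | cons B P ih =>
      rw [Multiset.countP_cons, Multiset.sum_cons, Multiset.card_add]
      split_ifs with h
      · have : 0 < B.card := by
          rw [Multiset.card_pos]
          rintro rfl
          norm_num at h
        omega
      · omega
  simpa [hP] using this P

theorem exists_forall_le_of_bounded {β : Type*} (p : β → Prop) (f : β → ℕ) (b : ℕ)
    (hex : ∃ a, p a) (hb : ∀ a, p a → f a ≤ b) : ∃ a, p a ∧ ∀ a', p a' → f a' ≤ f a := by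
  have hbdd : BddAbove (f '' {a | p a}) := ⟨b, by rintro _ ⟨a, ha, rfl⟩; exact hb a ha⟩
  obtain ⟨a, ha, hfa⟩ := Nat.sSup_mem (Set.Nonempty.image f hex) hbdd
  exact ⟨a, ha, fun a' ha' => hfa ▸ le_csSup hbdd ⟨a', ha', rfl⟩⟩

theorem exists_max_covering (σ : List ℚ) :
    ∃ P : Multiset (Multiset ℚ), P.sum = ↑σ ∧
      ∀ P' : Multiset (Multiset ℚ), P'.sum = ↑σ → coveredCount P' ≤ coveredCount P :=
  exists_forall_le_of_bounded (fun P : Multiset (Multiset ℚ) => P.sum = ↑σ) coveredCount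
    σ.length ⟨{↑σ}, Multiset.sum_singleton _⟩ (coveredCount_le_length σ)

/-- For every finite list `σ` of rational items in `(0,1)` there is advice
`m ≤ |σ|` and `x ∈ [1/2, 1]` such that `DH₂` with advice `(m, x)` covers at
least `(3/5)·OPT(σ) − 19/15` bins, where the optimum ranges over all partitions
of the multiset of items of `σ` into bins. -/
theorem dh2_three_fifths (σ : List ℚ) (hσ : ∀ v ∈ σ, 0 < v ∧ v < 1) :
    ∃ m ≤ σ.length, ∃ x : ℚ, 1/2 ≤ x ∧ x ≤ 1 ∧
      ∀ P : Multiset (Multiset ℚ), P.sum = ↑σ →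
        (3/5 : ℚ) * (coveredCount P : ℚ) - 19/15 ≤ (DH 2 m x σ : ℚ) := by
  obtain ⟨P₀, hP₀, hmax⟩ := exists_max_covering σ
  obtain ⟨N₀, N₁, N₂, M, x, hcov, hM, hx, hx1, hcx, hbig, hsmall, hweight⟩ :=
    exists_threshold_of_covering σ hσ P₀ hP₀
  suffices h : ∃ m ≤ M,
      (3 / 5 : ℚ) * (N₀ + N₁ + N₂) - 19 / 15 ≤ (DH 2 m x σ : ℚ) by
    obtain ⟨m, hm, hDH⟩ := h
    refine ⟨m, ?_, x, hx, hx1.le, fun P hP => ?_⟩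
    · have := hcx.trans (List.sum_ratIndicator_le_length (fun v => x ≤ v) σ)
      exact hm.trans (by exact_mod_cast this)
    · have : (coveredCount P : ℚ) ≤ N₀ + N₁ + N₂ := by
        exact_mod_cast (hmax P hP).trans hcov
      linarith
  have hM1 : 2 * (M : ℚ) ≤ N₁ := by
    have : 2 * M ≤ N₁ := by omega
    exact_mod_cast this
  have hM2 : (N₁ : ℚ) ≤ 2 * M + 1 := by
    have : N₁ ≤ 2 * M + 1 := by omega
    exact_mod_cast this
  have hc : 0 < 1 - x := by linarith
  have hN0 : (0 : ℚ) ≤ N₀ := Nat.cast_nonneg _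
  have hN2 : (0 : ℚ) ≤ N₂ := Nat.cast_nonneg _
  have hprod : 0 ≤ (N₁ - 2 * M : ℚ) * (1 - x) := mul_nonneg (by linarith) hc.le
  have hfull0 : ∀ c ∈ (dhFinal 0 x σ).crit, 1 ≤ c.2.2 := by
    have := (DHInvariant.final 0 hx hx1 σ hσ).length
    rw [List.length_eq_zero_iff.1 this]
    simp
  have hcases : (∀ c ∈ (dhFinal M x σ).crit, 1 ≤ c.2.2) ∨ ∃ k < M,
      (∀ c ∈ (dhFinal k x σ).crit, 1 ≤ c.2.2) ∧
        ¬ ∀ c ∈ (dhFinal (k + 1) x σ).crit, 1 ≤ c.2.2 := by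
    by_contra! hcon
    obtain ⟨hMf, hstep⟩ := hcon
    have : ∀ j ≤ M, ∀ c ∈ (dhFinal j x σ).crit, 1 ≤ c.2.2 := by
      intro j
      induction j with
      | zero => exact fun _ => hfull0
      | succ j ih => exact fun hj => hstep j (by omega) (ih (by omega))
    obtain ⟨c, hc, hc1⟩ := hMf
    exact absurd (this M le_rfl c hc) (not_le.2 hc1)
  rcases hcases with hfull | ⟨k, hkM, hfull, hnot⟩
  · refine ⟨M, le_rfl, ?_⟩
    obtain ⟨p, q, hDH, h1, h2⟩ := dh_of_full hx hx1 hσ hcx hfull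
    have hq : (0 : ℚ) ≤ q := Nat.cast_nonneg _
    rw [hDH]
    rcases le_total (M / 2 : ℚ) N₀ with h | h
    · linarith
    · linarith
  · have hkM' : (k : ℚ) + 1 ≤ M := by exact_mod_cast hkM
    refine ⟨k, hkM.le, ?_⟩
    obtain ⟨p, q, hDH, h1, -⟩ := dh_of_full hx hx1 hσ (by linarith : (k : ℚ) ≤ _) hfull
    have hq : (0 : ℚ) ≤ q := Nat.cast_nonneg _
    have hs := sum_smallWeight_lt_of_not_full hx hx1 hσ hnot id (1 / 2) (by norm_num)
      fun v hv => ⟨le_rfl, hv.le⟩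
    have hw := sum_smallWeight_lt_of_not_full hx hx1 hσ hnot (fun v => min v (1 - x)) (1 - x)
      hc.le fun v _ => ⟨min_le_left _ _, min_le_right _ _⟩
    have hkprod : 0 ≤ ((M : ℚ) - (k + 1)) * (1 - x) := mul_nonneg (by linarith) hc.le
    have hk1 : 2 * (N₀ : ℚ) ≤ k := by linarith
    have hk2 : 2 * (N₀ : ℚ) + (N₁ - M) < 2 * k + 1 := by
      have : (2 * (N₀ : ℚ) + (N₁ - M)) * (1 - x) < (2 * k + 1) * (1 - x) := by linarith
      exact lt_of_mul_lt_mul_right this hc.le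
    rw [hDH]
    linarith
end

section
/- For every finite list σ of rational items, each in the open interval (0, 1), there exist a natural number m (with m at most the length of σ) and a rational x with 1/2 ≤ x ≤ 1 such that the strategy DH₄ with advice parameters (m, x) covers at least (2/3)·OPT(σ) − 173/60 bins when serving σ, where OPT(σ) is the maximum number of covered bins over all partitions of the multiset of items of σ. -/
lemma updateFirst_eq_append {α : Type*} (p : α → Bool) (f : α → α) (l : List α)
    (h : l.any p = true) : ∃ l₁ a l₂, l = l₁ ++ a :: l₂ ∧ (∀ b ∈ l₁, p b = false) ∧ p a = true ∧
      updateFirst p f l = l₁ ++ f a :: l₂ := by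
  induction l with
  | nil => simp at h
  | cons a l ih =>
    by_cases ha : p a = true
    · exact ⟨[], a, l, by simp, by simp, ha, by simp [updateFirst, ha]⟩
    · have h' : l.any p = true := by simpa [ha] using h
      obtain ⟨l₁, b, l₂, e, h₁, hb, hu⟩ := ih h'
      refine ⟨a :: l₁, b, l₂, by simp [e], ?_, hb, by simp [updateFirst, ha, hu]⟩
      simpa [ha] using h₁

/-- The weight of an item of size at least `1/4`: a `t`-item weighs `1/t`. -/
def largeWeight (v : ℚ) : ℚ :=
  if 1/2 ≤ v then 1/2 else if 1/3 ≤ v then 1/3 else if 1/4 ≤ v then 1/4 else 0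

/-- The size of an item if it is small, and `0` otherwise. -/
def smallSize (v : ℚ) : ℚ := if v < 1/4 then v else 0

/-- The size of a small item, capped at `d`. -/
def cappedSize (d v : ℚ) : ℚ := if v < 1/4 then min v d else 0

lemma ceil_toNat_eq_two {v : ℚ} (h : 1/2 ≤ v) (h1 : v < 1) : ⌈1 / v⌉.toNat = 2 := by
  have hv : 0 < v := by linarith
  have : ⌈1 / v⌉ = 2 := by
    rw [Int.ceil_eq_iff]
    constructor
    · rw [lt_div_iff₀ hv]; push_cast; linarith
    · rw [div_le_iff₀ hv]; push_cast; linarith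
  rw [this]; rfl

lemma ceil_toNat_eq_three {v : ℚ} (h : 1/3 ≤ v) (h1 : v < 1/2) : ⌈1 / v⌉.toNat = 3 := by
  have hv : 0 < v := by linarith
  have : ⌈1 / v⌉ = 3 := by
    rw [Int.ceil_eq_iff]
    constructor
    · rw [lt_div_iff₀ hv]; push_cast; linarith
    · rw [div_le_iff₀ hv]; push_cast; linarith
  rw [this]; rfl

lemma ceil_toNat_eq_four {v : ℚ} (h : 1/4 ≤ v) (h1 : v < 1/3) : ⌈1 / v⌉.toNat = 4 := by
  have hv : 0 < v := by linarith
  have : ⌈1 / v⌉ = 4 := by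
    rw [Int.ceil_eq_iff]
    constructor
    · rw [lt_div_iff₀ hv]; push_cast; linarith
    · rw [div_le_iff₀ hv]; push_cast; linarith
  rw [this]; rfl

/-- A bound on the capped volume of small items in a list of critical bins with threshold `x`. -/
def fillBound (x : ℚ) : List (Bool × ℚ × ℚ) → ℚ
  | [] => 0
  | c :: l => if 1 ≤ c.2.2 then 2 * (1 - x) + fillBound x l else c.2.2 - x

lemma fillBound_nonneg {x : ℚ} (hx : x ≤ 1) (l : List (Bool × ℚ × ℚ))
    (h : ∀ c ∈ l, x ≤ c.2.2) : 0 ≤ fillBound x l := by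
  induction l with
  | nil => simp [fillBound]
  | cons c l ih =>
    have h1 := h c (by simp)
    have h2 := ih fun c hc => h c (by simp [hc])
    unfold fillBound
    split_ifs <;> linarith

lemma fillBound_le {x : ℚ} (hx : x ≤ 1) (l : List (Bool × ℚ × ℚ))
    (h : ¬ ∀ c ∈ l, 1 ≤ c.2.2) : fillBound x l ≤ (1 - x) * (2 * l.length - 1) := by
  induction l with
  | nil => simp at h
  | cons c l ih =>
    unfold fillBound
    push_cast [List.length_cons]
    split_ifs with hc
    · have : ¬ ∀ c ∈ l, 1 ≤ c.2.2 := by simpa [hc] using h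
      nlinarith [ih this]
    · have : (0 : ℚ) ≤ l.length := by positivity
      nlinarith

lemma fillBound_mono {x : ℚ} (hx : x ≤ 1) (l₁ l₂ : List (Bool × ℚ × ℚ)) (a b : Bool × ℚ × ℚ)
    (hab : a.2.2 ≤ b.2.2) (h : ∀ c ∈ l₂, x ≤ c.2.2) :
    fillBound x (l₁ ++ a :: l₂) ≤ fillBound x (l₁ ++ b :: l₂) := by
  induction l₁ with
  | nil =>
    have := fillBound_nonneg hx l₂ h
    simp only [List.nil_append, fillBound]
    split_ifs <;> linarith
  | cons c l ih =>
    simp only [List.cons_append, fillBound]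
    split_ifs <;> linarith

lemma fillBound_add_le {x v : ℚ} (hx : x ≤ 1) (l₁ l₂ : List (Bool × ℚ × ℚ))
    (a b : Bool × ℚ × ℚ) (h₁ : ∀ c ∈ l₁, 1 ≤ c.2.2) (ha : a.2.2 < 1)
    (hab : b.2.2 = a.2.2 + v) (h : ∀ c ∈ l₂, x ≤ c.2.2) :
    fillBound x (l₁ ++ a :: l₂) + min v (1 - x) ≤ fillBound x (l₁ ++ b :: l₂) := by
  induction l₁ with
  | nil =>
    have := fillBound_nonneg hx l₂ h
    have h1 := min_le_left v (1 - x)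
    have h2 := min_le_right v (1 - x)
    simp only [List.nil_append, fillBound]
    split_ifs <;> linarith
  | cons c l ih =>
    have hc := h₁ c (by simp)
    have := ih fun c hc => h₁ c (by simp [hc])
    simp only [List.cons_append, fillBound, if_pos hc]
    linarith

/-- A bound on the volume of small items in a critical bin with threshold `x`. -/
def fill (x : ℚ) (c : Bool × ℚ × ℚ) : ℚ := min (c.2.2 - x) (5/4 - x)

/-- Bookkeeping invariant of `DH₄` with advice `(m, x)` after serving the items `p`; `n₂`, `n₃`,
`n₄` count the items in the active bins. -/
structure DHInv (m : ℕ) (x : ℚ) (st : DHState) (p : Multiset ℚ) : Prop where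
  length_crit : st.crit.length = m
  crit : ∀ c ∈ st.crit, x ≤ c.2.2 ∧ c.2.1 = if c.1 then c.2.2 else c.2.2 - x
  flags : (∀ c ∈ st.crit, c.1 = true) ∨ st.crit.countP (·.1) = p.countP (x ≤ ·)
  small : st.small < 1
  weights : ∃ n₂ n₃ n₄ : ℕ, n₂ ≤ 1 ∧ n₃ ≤ 2 ∧ n₄ ≤ 3 ∧
    n₂ ≤ 2 * st.bins 2 ∧ n₃ ≤ 3 * st.bins 3 ∧ n₄ ≤ 4 * st.bins 4 ∧
    (p.map largeWeight).sum ≤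
      st.count + (st.crit.countP (·.1) : ℕ) / 2 + (n₂ / 2 + n₃ / 3 + n₄ / 4) ∧
    (p.map largeWeight).sum + 4/5 * (p.map smallSize).sum ≤
      st.count + (st.crit.countP (·.1) : ℕ) / 2 + (n₂ / 2 + n₃ / 3 + n₄ / 4) +
        4/5 * st.small + 4/5 * (st.crit.map (fill x)).sum
  capped : (∀ c ∈ st.crit, 1 ≤ c.2.2) ∨ (p.map (cappedSize (1 - x))).sum ≤ fillBound x st.crit

lemma DHInv.init {m : ℕ} {x : ℚ} (hx : x ≤ 1) :
    DHInv m x ⟨List.replicate m (false, (0 : ℚ), x), fun _ => 0, 0, 0⟩ 0 := by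
  have h : ∀ c ∈ List.replicate m (false, (0 : ℚ), x), x ≤ c.2.2 ∧
      c.2.1 = if c.1 then c.2.2 else c.2.2 - x := by
    intro c hc
    rw [List.eq_of_mem_replicate hc]; simp
  refine ⟨by simp, h, Or.inr ?_, by norm_num, ⟨0, 0, 0, ?_⟩, Or.inr ?_⟩
  · simp [List.countP_replicate]
  · have : min 0 (5/4 - x) = 0 := min_eq_left (by linarith)
    simp [List.countP_replicate, fill, this]
  · simpa using fillBound_nonneg hx _ fun c hc => (h c hc).1

lemma DHInv.step {m : ℕ} {x : ℚ} {st : DHState} {p : Multiset ℚ} (hx : 1/2 ≤ x) (hx1 : x ≤ 1)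
    (h : DHInv m x st p) {v : ℚ} (hv : 0 < v) (hv1 : v < 1) :
    DHInv m x (dhStep 4 x st v) (v ::ₘ p) := by
  obtain ⟨hlen, hcrit, hflags, hsmall, ⟨n₂, n₃, n₄, b₂, b₃, b₄, e₂, e₃, e₄, w₁, w₂⟩, hcap⟩ := h
  unfold dhStep
  split_ifs with c1 c2 c3 c4
  · obtain ⟨hxv, hany⟩ := c1
    obtain ⟨l₁, a, l₂, hl, hl₁, ha, hu⟩ := updateFirst_eq_append (fun c => !c.1)
      (fun c => (true, c.2.1 + v, c.2.2 + (v - x))) st.crit hany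
    have ha' : a.1 = false := by simpa using ha
    have hv4 : ¬ v < 1/4 := by linarith
    have hv2 : 1/2 ≤ v := by linarith
    rw [hl] at hlen hcrit hflags w₁ w₂ hcap
    have hca := hcrit a (by simp)
    have hfl : (l₁ ++ (true, a.2.1 + v, a.2.2 + (v - x)) :: l₂).countP (·.1) =
        (l₁ ++ a :: l₂).countP (·.1) + 1 := by
      simp [List.countP_append, ha']; omega
    have hfill : ((l₁ ++ a :: l₂).map (fill x)).sum ≤
        ((l₁ ++ (true, a.2.1 + v, a.2.2 + (v - x)) :: l₂).map (fill x)).sum := by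
      have : fill x a ≤ fill x (true, a.2.1 + v, a.2.2 + (v - x)) := by
        unfold fill
        exact min_le_min_right _ (by simp; linarith)
      simp; linarith
    constructor
    · simp [hu]; simpa using hlen
    · simp only [hu]
      intro c hc
      simp only [List.mem_append, List.mem_cons] at hc
      rcases hc with hc | rfl | hc
      · exact hcrit c (by simp [hc])
      · rw [ha'] at hca
        simp at hca
        simp [hca.2]; exact ⟨by linarith [hca.1], by ring⟩
      · exact hcrit c (by simp [hc])
    · right
      simp only [hu, hfl]
      rcases hflags with hf | hf
      · have := hf a (by simp)
        simp [ha'] at this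
      · rw [hf, Multiset.countP_cons_of_pos _ hxv]
    · exact hsmall
    · refine ⟨n₂, n₃, n₄, b₂, b₃, b₄, e₂, e₃, e₄, ?_, ?_⟩
      · simp only [hu, hfl, Multiset.map_cons, Multiset.sum_cons, largeWeight, if_pos hv2]
        push_cast; linarith
      · simp only [hu, hfl, Multiset.map_cons, Multiset.sum_cons, largeWeight, if_pos hv2,
          smallSize, if_neg hv4]
        push_cast; linarith
    · simp only [hu, Multiset.map_cons, Multiset.sum_cons, cappedSize, if_neg hv4, zero_add]
      rcases hcap with hc | hc
      · left
        intro c hc'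
        simp only [List.mem_append, List.mem_cons] at hc'
        rcases hc' with hc' | rfl | hc'
        · exact hc c (by simp [hc'])
        · have := hc a (by simp)
          simp; linarith
        · exact hc c (by simp [hc'])
      · right
        refine hc.trans (fillBound_mono hx1 _ _ _ _ (by simp; linarith) ?_)
        exact fun c hc => (hcrit c (by simp [hc])).1
  all_goals
    have hfl' : (∀ c ∈ st.crit, c.1 = true) ∨
        st.crit.countP (·.1) = (v ::ₘ p).countP (x ≤ ·) := by
      rcases hflags with hf | hf
      · exact Or.inl hf
      · by_cases hxv : x ≤ v
        · left
          intro c hc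
          by_contra hne
          exact c1 ⟨hxv, List.any_eq_true.2 ⟨c, hc, by simpa using hne⟩⟩
        · right
          rw [Multiset.countP_cons_of_neg _ hxv, hf]
  · have c2' : 1/4 ≤ v := by simpa using c2
    have hv4 : ¬ v < 1/4 := not_lt.2 c2'
    have hcap' : (∀ c ∈ st.crit, 1 ≤ c.2.2) ∨
        ((v ::ₘ p).map (cappedSize (1 - x))).sum ≤ fillBound x st.crit := by
      simpa only [Multiset.map_cons, Multiset.sum_cons, cappedSize, if_neg hv4, zero_add]
        using hcap
    have hs : ((v ::ₘ p).map smallSize).sum = (p.map smallSize).sum := by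
      simp only [Multiset.map_cons, Multiset.sum_cons, smallSize, if_neg hv4, zero_add]
    have hw : ((v ::ₘ p).map largeWeight).sum = largeWeight v + (p.map largeWeight).sum := by
      simp
    have hb : ((n₂ : ℚ) ≤ 1 ∧ (n₃ : ℚ) ≤ 2) ∧ (n₄ : ℚ) ≤ 3 := by
      exact_mod_cast (⟨⟨b₂, b₃⟩, b₄⟩ : (n₂ ≤ 1 ∧ n₃ ≤ 2) ∧ n₄ ≤ 3)
    obtain ⟨⟨b₂', b₃'⟩, b₄'⟩ := hb
    dsimp only
    rcases lt_or_ge v (1/2) with v2 | v2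
    · rcases lt_or_ge v (1/3) with v3 | v3
      · have hl : largeWeight v = 1/4 := by
          simp only [largeWeight, if_neg (not_le.2 v2), if_neg (not_le.2 v3), if_pos c2']
        rw [ceil_toNat_eq_four c2' v3]
        split_ifs with c5
        · refine ⟨hlen, hcrit, hfl', hsmall, ⟨n₂, n₃, 0, b₂, b₃, by omega, ?_⟩, hcap'⟩
          rw [hs, hw, hl]
          simp
          refine ⟨e₂, e₃, ?_, ?_⟩ <;> linarith
        · have hn : n₄ + 1 ≤ 3 := by
            have : (n₄ : ℚ) + 1 < 4 := by linarith
            have : n₄ + 1 < 4 := by exact_mod_cast this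
            omega
          refine ⟨hlen, hcrit, hfl', hsmall, ⟨n₂, n₃, n₄ + 1, b₂, b₃, hn, ?_⟩, hcap'⟩
          rw [hs, hw, hl]
          simp
          refine ⟨e₂, e₃, ?_, ?_, ?_⟩ <;> linarith
      · have hl : largeWeight v = 1/3 := by
          simp only [largeWeight, if_neg (not_le.2 v2), if_pos v3]
        rw [ceil_toNat_eq_three v3 v2]
        split_ifs with c5
        · refine ⟨hlen, hcrit, hfl', hsmall, ⟨n₂, 0, n₄, b₂, by omega, b₄, ?_⟩, hcap'⟩
          rw [hs, hw, hl]
          simp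
          refine ⟨e₂, e₄, ?_, ?_⟩ <;> linarith
        · have hn : n₃ + 1 ≤ 2 := by
            have : (n₃ : ℚ) + 1 < 3 := by linarith
            have : n₃ + 1 < 3 := by exact_mod_cast this
            omega
          refine ⟨hlen, hcrit, hfl', hsmall, ⟨n₂, n₃ + 1, n₄, b₂, hn, b₄, ?_⟩, hcap'⟩
          rw [hs, hw, hl]
          simp
          refine ⟨e₂, ?_, e₄, ?_, ?_⟩ <;> linarith
    · have hl : largeWeight v = 1/2 := by
        simp only [largeWeight, if_pos v2]
      rw [ceil_toNat_eq_two v2 hv1]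
      split_ifs with c5
      · refine ⟨hlen, hcrit, hfl', hsmall, ⟨0, n₃, n₄, by omega, b₃, b₄, ?_⟩, hcap'⟩
        rw [hs, hw, hl]
        simp
        refine ⟨e₃, e₄, ?_, ?_⟩ <;> linarith
      · have hn : n₂ + 1 ≤ 1 := by
          have : (n₂ : ℚ) + 1 < 2 := by linarith
          have : n₂ + 1 < 2 := by exact_mod_cast this
          omega
        refine ⟨hlen, hcrit, hfl', hsmall, ⟨n₂ + 1, n₃, n₄, hn, b₃, b₄, ?_⟩, hcap'⟩
        rw [hs, hw, hl]
        simp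
        refine ⟨?_, e₃, e₄, ?_, ?_⟩ <;> linarith
  all_goals
    have hv4 : v < 1/4 := by simpa using c2
    have hs : ((v ::ₘ p).map smallSize).sum = v + (p.map smallSize).sum := by
      simp only [Multiset.map_cons, Multiset.sum_cons, smallSize, if_pos hv4]
    have hl : largeWeight v = 0 := by
      simp only [largeWeight, if_neg (show ¬ 1/2 ≤ v by linarith),
        if_neg (show ¬ 1/3 ≤ v by linarith), if_neg (not_le.2 hv4)]
    have hw : ((v ::ₘ p).map largeWeight).sum = (p.map largeWeight).sum := by
      simp [hl]
  · obtain ⟨l₁, a, l₂, hl, hl₁, ha, hu⟩ := updateFirst_eq_append (fun c => decide (c.2.2 < 1))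
      (fun c => (c.1, c.2.1 + v, c.2.2 + v)) st.crit c3
    have ha' : a.2.2 < 1 := by simpa using ha
    rw [hl] at hlen hcrit hfl' w₁ w₂ hcap
    have hca := hcrit a (by simp)
    have hfl : (l₁ ++ (a.1, a.2.1 + v, a.2.2 + v) :: l₂).countP (·.1) =
        (l₁ ++ a :: l₂).countP (·.1) := by
      simp [List.countP_append, List.countP_cons]
    have hfill : ((l₁ ++ a :: l₂).map (fill x)).sum + v =
        ((l₁ ++ (a.1, a.2.1 + v, a.2.2 + v) :: l₂).map (fill x)).sum := by
      have : fill x a + v = fill x (a.1, a.2.1 + v, a.2.2 + v) := by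
        unfold fill
        dsimp only
        rw [min_eq_left (by linarith), min_eq_left (by linarith)]
        ring
      simp; linarith
    refine ⟨?_, ?_, ?_, hsmall, ⟨n₂, n₃, n₄, b₂, b₃, b₄, e₂, e₃, e₄, ?_, ?_⟩, ?_⟩
    · simp [hu]; simpa using hlen
    · simp only [hu]
      intro c hc
      simp only [List.mem_append, List.mem_cons] at hc
      rcases hc with hc | rfl | hc
      · exact hcrit c (by simp [hc])
      · refine ⟨by linarith [hca.1], ?_⟩
        dsimp only
        rw [hca.2]
        split_ifs <;> ring
      · exact hcrit c (by simp [hc])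
    · simp only [hu, hfl]
      rcases hfl' with hf | hf
      · left
        intro c hc
        simp only [List.mem_append, List.mem_cons] at hc
        rcases hc with hc | rfl | hc
        · exact hf c (by simp [hc])
        · exact hf a (by simp)
        · exact hf c (by simp [hc])
      · exact Or.inr hf
    · simp only [hu, hfl, hw]
      exact w₁
    · simp only [hu, hfl, hw, hs, ← hfill]
      linarith
    · right
      simp only [hu, Multiset.map_cons, Multiset.sum_cons, cappedSize, if_pos hv4]
      have hc : (p.map (cappedSize (1 - x))).sum ≤ fillBound x (l₁ ++ a :: l₂) := by
        rcases hcap with hc | hc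
        · linarith [hc a (by simp)]
        · exact hc
      have := fillBound_add_le (v := v) hx1 l₁ l₂ a (a.1, a.2.1 + v, a.2.2 + v)
        (fun c hc => by simpa using hl₁ c hc) ha' rfl (fun c hc => (hcrit c (by simp [hc])).1)
      linarith
  · refine ⟨hlen, hcrit, hfl', by norm_num, ⟨n₂, n₃, n₄, b₂, b₃, b₄, e₂, e₃, e₄, ?_⟩,
      Or.inl (by simpa using c3)⟩
    rw [hs, hw]
    push_cast
    constructor <;> linarith
  · refine ⟨hlen, hcrit, hfl', not_le.1 c4, ⟨n₂, n₃, n₄, b₂, b₃, b₄, e₂, e₃, e₄, ?_⟩,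
      Or.inl (by simpa using c3)⟩
    rw [hs, hw]
    dsimp only
    constructor <;> linarith

/-- The state of `DH₄` with advice `(m, x)` after serving `σ`. -/
def dhState (m : ℕ) (x : ℚ) (σ : List ℚ) : DHState :=
  σ.foldl (dhStep 4 x) ⟨List.replicate m (false, (0 : ℚ), x), fun _ => 0, 0, 0⟩

/-- All critical bins reach virtual load `1` when `DH₄` serves `σ` with advice `(m, x)`. -/
def AllFilled (m : ℕ) (x : ℚ) (σ : List ℚ) : Prop := ∀ c ∈ (dhState m x σ).crit, 1 ≤ c.2.2

lemma dhInv_dhState {m : ℕ} {x : ℚ} (hx : 1/2 ≤ x) (hx1 : x ≤ 1) {σ : List ℚ}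
    (hσ : ∀ v ∈ σ, 0 < v ∧ v < 1) : DHInv m x (dhState m x σ) ↑σ := by
  have key : ∀ (τ : List ℚ) (st : DHState) (p : Multiset ℚ), (∀ v ∈ τ, 0 < v ∧ v < 1) →
      DHInv m x st p → DHInv m x (τ.foldl (dhStep 4 x) st) (↑τ + p) := by
    intro τ
    induction τ with
    | nil => intro st p _ h; simpa using h
    | cons v τ ih =>
      intro st p hτ h
      have hv := hτ v (by simp)
      have := ih _ _ (fun w hw => hτ w (by simp [hw])) (h.step hx hx1 hv.1 hv.2)
      rw [← Multiset.cons_coe, Multiset.cons_add, ← Multiset.add_cons]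
      exact this
  simpa [dhState] using key σ _ 0 hσ (DHInv.init hx1)

lemma le_DH_of_allFilled {m : ℕ} {x : ℚ} (hx : 1/2 ≤ x) (hx1 : x ≤ 1) {σ : List ℚ}
    (hσ : ∀ v ∈ σ, 0 < v ∧ v < 1) (hm : m ≤ (σ : Multiset ℚ).countP (x ≤ ·))
    (hf : AllFilled m x σ) :
    ((σ : Multiset ℚ).map largeWeight).sum + m / 2 - 23/12 ≤ DH 4 m x σ ∧
    ((σ : Multiset ℚ).map largeWeight).sum + 4/5 * ((σ : Multiset ℚ).map smallSize).sum
      + m / 2 - 4/5 * (m * (5/4 - x)) - 163/60 ≤ DH 4 m x σ := by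
  obtain ⟨hlen, hcrit, hflags, hsmall, ⟨n₂, n₃, n₄, b₂, b₃, b₄, -, -, -, w₁, w₂⟩, -⟩ :=
    dhInv_dhState (m := m) hx hx1 hσ
  have hall : ∀ c ∈ (dhState m x σ).crit, c.1 = true := by
    rcases hflags with h | h
    · exact h
    · refine List.countP_eq_length.1 (le_antisymm List.countP_le_length ?_)
      rw [h, hlen]; exact hm
  have hDH : DH 4 m x σ = (dhState m x σ).count + m := by
    change (dhState m x σ).count + (dhState m x σ).crit.countP (fun c => decide (1 ≤ c.2.1)) = _
    rw [List.countP_eq_length.2, hlen]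
    intro c hc
    have := (hcrit c hc).2
    rw [if_pos (hall c hc)] at this
    simpa [this] using hf c hc
  have hfl : (dhState m x σ).crit.countP (·.1) = m := by
    rw [List.countP_eq_length.2 hall, hlen]
  have hfill : ((dhState m x σ).crit.map (fill x)).sum ≤ m * (5/4 - x) := by
    have := List.sum_le_card_nsmul ((dhState m x σ).crit.map (fill x)) (5/4 - x) (by
      intro q hq
      obtain ⟨c, -, rfl⟩ := List.mem_map.1 hq
      exact min_le_right _ _)
    simpa [hlen] using this
  have hb : ((n₂ : ℚ) ≤ 1 ∧ (n₃ : ℚ) ≤ 2) ∧ (n₄ : ℚ) ≤ 3 := by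
    exact_mod_cast (⟨⟨b₂, b₃⟩, b₄⟩ : (n₂ ≤ 1 ∧ n₃ ≤ 2) ∧ n₄ ≤ 3)
  obtain ⟨⟨b₂', b₃'⟩, b₄'⟩ := hb
  rw [hfl] at w₁ w₂
  rw [hDH]
  push_cast
  constructor <;> linarith

lemma sum_cappedSize_le_of_not_allFilled {m : ℕ} {x : ℚ} (hx : 1/2 ≤ x) (hx1 : x ≤ 1)
    {σ : List ℚ} (hσ : ∀ v ∈ σ, 0 < v ∧ v < 1) (hf : ¬ AllFilled m x σ) :
    ((σ : Multiset ℚ).map (cappedSize (1 - x))).sum ≤ (1 - x) * (2 * m - 1) := by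
  have h := dhInv_dhState (m := m) hx hx1 hσ
  have := fillBound_le hx1 _ hf
  rw [h.length_crit] at this
  exact (h.capped.resolve_left hf).trans this

lemma allFilled_zero (x : ℚ) {σ : List ℚ} (hx : 1/2 ≤ x) (hx1 : x ≤ 1)
    (hσ : ∀ v ∈ σ, 0 < v ∧ v < 1) : AllFilled 0 x σ := by
  have h := (dhInv_dhState (m := 0) hx hx1 hσ).length_crit
  intro c hc
  rw [List.length_eq_zero_iff.1 h] at hc
  simp at hc

section Bins

variable {B : Multiset ℚ}

lemma largeWeight_nonneg (v : ℚ) : 0 ≤ largeWeight v := by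
  unfold largeWeight
  split_ifs <;> norm_num

lemma smallSize_nonneg {v : ℚ} (hv : 0 < v) : 0 ≤ smallSize v := by
  unfold smallSize
  split_ifs <;> linarith

/-- A covered bin is deficient if its large items weigh too little. -/
def IsDeficient (B : Multiset ℚ) : Prop :=
  1 ≤ B.sum ∧ (B.map largeWeight).sum + 2/3 * (B.map smallSize).sum < 2/3

lemma two_thirds_mul_sum_le (hB : ∀ v ∈ B, 0 < v ∧ v < 1/2) :
    2/3 * B.sum ≤ (B.map largeWeight).sum + 2/3 * (B.map smallSize).sum := by
  induction B using Multiset.induction with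
  | empty => simp
  | cons v B ih =>
    have hv := hB v (by simp)
    have := ih fun w hw => hB w (by simp [hw])
    have h : 2/3 * v ≤ largeWeight v + 2/3 * smallSize v := by
      unfold largeWeight smallSize
      split_ifs <;> linarith
    simp only [Multiset.sum_cons, Multiset.map_cons]
    linarith

lemma sum_largeWeight_of_small (hB : ∀ v ∈ B, v < 1/4) : (B.map largeWeight).sum = 0 := by
  refine Multiset.sum_eq_zero fun q hq => ?_
  obtain ⟨v, hv, rfl⟩ := Multiset.mem_map.1 hq
  have := hB v hv
  unfold largeWeight
  rw [if_neg, if_neg, if_neg] <;> linarith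

lemma sum_smallSize_of_small (hB : ∀ v ∈ B, v < 1/4) : (B.map smallSize).sum = B.sum := by
  rw [Multiset.map_congr rfl fun v hv => by
    rw [smallSize, if_pos (hB v hv)], Multiset.map_id']

lemma IsDeficient.exists_eq_cons (h : IsDeficient B) (hB : ∀ v ∈ B, 0 < v ∧ v < 1) :
    ∃ v R, B = v ::ₘ R ∧ 3/4 < v ∧ ∀ r ∈ R, r < 1/4 := by
  obtain ⟨h1, h2⟩ := h
  by_cases hall : ∀ v ∈ B, v < 1/2
  · have := two_thirds_mul_sum_le fun v hv => ⟨(hB v hv).1, hall v hv⟩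
    linarith
  push Not at hall
  obtain ⟨v, hv, hv2⟩ := hall
  obtain ⟨R, rfl⟩ := Multiset.exists_cons_of_mem hv
  have hR : ∀ r ∈ R, 0 < r := fun r hr => (hB r (by simp [hr])).1
  have hv4 : ¬ v < 1/4 := by linarith
  have hsm : 0 ≤ (R.map smallSize).sum := Multiset.sum_nonneg fun q hq => by
    obtain ⟨r, hr, rfl⟩ := Multiset.mem_map.1 hq
    exact smallSize_nonneg (hR r hr)
  simp only [Multiset.map_cons, Multiset.sum_cons, largeWeight, if_pos hv2, smallSize,
    if_neg hv4, zero_add] at h1 h2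
  have hsmall : ∀ r ∈ R, r < 1/4 := by
    intro r hr
    by_contra hr4
    have h3 : largeWeight r ≤ (R.map largeWeight).sum :=
      Multiset.single_le_sum (fun q hq => by
        obtain ⟨r, -, rfl⟩ := Multiset.mem_map.1 hq
        exact largeWeight_nonneg r) _ (Multiset.mem_map_of_mem _ hr)
    have h4 : 1/4 ≤ largeWeight r := by
      unfold largeWeight
      rw [if_pos (not_lt.1 hr4)]
      split_ifs <;> norm_num
    linarith
  refine ⟨v, R, rfl, ?_, hsmall⟩
  have h5 := sum_smallSize_of_small hsmall
  have h6 := sum_largeWeight_of_small hsmall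
  linarith

/-- The total size of the items of size at least `1/2` in a bin. -/
def topSize (B : Multiset ℚ) : ℚ := (B.filter (1/2 ≤ ·)).sum

lemma topSize_cons {v : ℚ} {R : Multiset ℚ} (hv : 3/4 < v) (hR : ∀ r ∈ R, r < 1/4) :
    topSize (v ::ₘ R) = v := by
  unfold topSize
  rw [Multiset.filter_cons_of_pos _ (by linarith), Multiset.filter_eq_nil.2]
  · simp
  · intro r hr
    linarith [hR r hr]

lemma IsDeficient.three_quarters_lt_topSize (h : IsDeficient B)
    (hB : ∀ v ∈ B, 0 < v ∧ v < 1) : 3/4 < topSize B := by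
  obtain ⟨v, R, rfl, hv, hR⟩ := h.exists_eq_cons hB
  rwa [topSize_cons hv hR]

lemma IsDeficient.topSize_mem (h : IsDeficient B) (hB : ∀ v ∈ B, 0 < v ∧ v < 1) :
    topSize B ∈ B := by
  obtain ⟨v, R, rfl, hv, hR⟩ := h.exists_eq_cons hB
  simp [topSize_cons hv hR]

lemma IsDeficient.sum_largeWeight (h : IsDeficient B) (hB : ∀ v ∈ B, 0 < v ∧ v < 1) :
    (B.map largeWeight).sum = 1/2 := by
  obtain ⟨v, R, rfl, hv, hR⟩ := h.exists_eq_cons hB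
  rw [Multiset.map_cons, Multiset.sum_cons, sum_largeWeight_of_small hR, largeWeight,
    if_pos (by linarith), add_zero]

lemma min_sum_smallSize_le {d : ℚ} (hd : 0 ≤ d) (hB : ∀ v ∈ B, 0 < v ∧ v < 1) :
    min (B.map smallSize).sum d ≤ (B.map (cappedSize d)).sum := by
  induction B using Multiset.induction with
  | empty => simp [hd]
  | cons v B ih =>
    have hv := (hB v (by simp)).1
    have ih := ih fun w hw => hB w (by simp [hw])
    have h0 : 0 ≤ (B.map (cappedSize d)).sum := Multiset.sum_nonneg fun q hq => by
      obtain ⟨r, hr, rfl⟩ := Multiset.mem_map.1 hq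
      have := (hB r (by simp [hr])).1
      unfold cappedSize
      split_ifs
      · exact le_min this.le hd
      · exact le_rfl
    simp only [Multiset.map_cons, Multiset.sum_cons]
    generalize (B.map smallSize).sum = S at *
    generalize (B.map (cappedSize d)).sum = T at *
    unfold smallSize cappedSize
    split_ifs
    · rcases min_cases v d with h | h <;> rcases min_cases S d with h' | h' <;>
        rcases min_cases (v + S) d with h'' | h'' <;> linarith
    · simpa using ih

lemma IsDeficient.le_sum_cappedSize (h : IsDeficient B) (hB : ∀ v ∈ B, 0 < v ∧ v < 1) {x : ℚ}
    (hx1 : x ≤ 1) (hx : topSize B ≤ x) : 1 - x ≤ (B.map (cappedSize (1 - x))).sum := by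
  refine le_trans (le_min ?_ le_rfl) (min_sum_smallSize_le (sub_nonneg.2 hx1) hB)
  have h1 := h.1
  obtain ⟨v, R, rfl, hv, hR⟩ := h.exists_eq_cons hB
  rw [topSize_cons hv hR] at hx
  rw [Multiset.sum_cons] at h1
  rw [Multiset.map_cons, Multiset.sum_cons, sum_smallSize_of_small hR, smallSize,
    if_neg (by linarith)]
  linarith

lemma mul_sum_smallSize_le {d : ℚ} (hd : 0 ≤ d) (hd1 : d ≤ 1/4) (hB : ∀ v ∈ B, 0 < v ∧ v < 1) :
    4 * d * (B.map smallSize).sum ≤ (B.map (cappedSize d)).sum := by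
  rw [← Multiset.sum_map_mul_left]
  refine Multiset.sum_map_le_sum_map _ _ fun v hv => ?_
  have := (hB v hv).1
  unfold smallSize cappedSize
  split_ifs with h
  · refine le_min ?_ ?_ <;> nlinarith
  · simp

end Bins

lemma sum_map_multisetSum {f : ℚ → ℚ} (P : Multiset (Multiset ℚ)) :
    (P.sum.map f).sum = (P.map fun B => (B.map f).sum).sum := by
  induction P using Multiset.induction with
  | empty => simp
  | cons B P ih => simp [ih]

/-- Every multiset of rationals has an element of each prescribed rank. -/
lemma exists_orderStatistic (V : Multiset ℚ) {k : ℕ} (hk : k < V.card) :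
    ∃ x ∈ V, k + 1 ≤ V.countP (x ≤ ·) ∧ V.card ≤ V.countP (· ≤ x) + k := by
  obtain ⟨l, hl, hs⟩ : ∃ l : List ℚ, (l : Multiset ℚ) = V ∧ l.Pairwise (· ≥ ·) :=
    ⟨V.sort (· ≥ ·), V.sort_eq _, V.pairwise_sort _⟩
  subst hl
  have hk' : k < l.length := by simpa using hk
  obtain ⟨a, hal, hsplit⟩ : ∃ a ∈ l, l = l.take k ++ a :: l.drop (k + 1) :=
    ⟨l[k], by simp, by rw [← List.drop_eq_getElem_cons, List.take_append_drop]⟩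
  rw [hsplit, List.pairwise_append, List.pairwise_cons] at hs
  obtain ⟨-, ⟨h2, -⟩, h1⟩ := hs
  refine ⟨a, hal, ?_, ?_⟩
  · have : (l.take k).countP (fun b => decide (a ≤ b)) = (l.take k).length :=
      List.countP_eq_length.2 fun b hb => by simpa using h1 b hb a (by simp)
    rw [Multiset.coe_countP, hsplit, List.countP_append, List.countP_cons, this]
    simp
    omega
  · have : (l.drop (k + 1)).countP (fun b => decide (b ≤ a)) = (l.drop (k + 1)).length :=
      List.countP_eq_length.2 fun b hb => by simpa using h2 b hb
    rw [Multiset.coe_countP, Multiset.coe_card]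
    conv_rhs => rw [hsplit]
    rw [List.countP_append, List.countP_cons, this]
    simp
    omega

open Classical in
/-- The total size of the small items outside deficient bins. -/
noncomputable def regularSmallSize (P : Multiset (Multiset ℚ)) : ℚ :=
  (P.map fun B => if IsDeficient B then 0 else (B.map smallSize).sum).sum

section Packings

open Classical

variable {P : Multiset (Multiset ℚ)}

lemma two_thirds_mul_coveredCount_le (hP : ∀ B ∈ P, ∀ v ∈ B, 0 < v ∧ v < 1) :
    2/3 * (coveredCount P : ℚ) ≤ (P.sum.map largeWeight).sum + P.countP IsDeficient / 6 +
      2/3 * regularSmallSize P := by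
  rw [coveredCount, ← Multiset.countP_eq_card_filter]
  unfold regularSmallSize
  induction P using Multiset.induction with
  | empty => simp
  | cons B P ih =>
    have ih := ih fun B hB => hP B (by simp [hB])
    have hB := hP B (by simp)
    simp only [Multiset.countP_cons, Multiset.map_cons, Multiset.sum_cons, Multiset.map_add,
      Multiset.sum_add]
    have h1 : 0 ≤ (B.map largeWeight).sum := Multiset.sum_nonneg fun q hq => by
      obtain ⟨r, -, rfl⟩ := Multiset.mem_map.1 hq
      exact largeWeight_nonneg r
    have h2 : 0 ≤ (B.map smallSize).sum := Multiset.sum_nonneg fun q hq => by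
      obtain ⟨r, hr, rfl⟩ := Multiset.mem_map.1 hq
      exact smallSize_nonneg (hB r hr).1
    by_cases hd : IsDeficient B
    · have := hd.sum_largeWeight hB
      rw [if_pos hd, if_pos hd, if_pos hd.1]
      push_cast
      linarith
    · rw [if_neg hd, if_neg hd]
      split_ifs with hc
      · have : 2/3 ≤ (B.map largeWeight).sum + 2/3 * (B.map smallSize).sum :=
          not_lt.1 fun h => hd ⟨hc, h⟩
        push_cast
        linarith
      · push_cast
        linarith

lemma regularSmallSize_le (hP : ∀ B ∈ P, ∀ v ∈ B, 0 < v ∧ v < 1) :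
    regularSmallSize P ≤ (P.sum.map smallSize).sum := by
  rw [sum_map_multisetSum]
  refine Multiset.sum_map_le_sum_map _ _ fun B hB => ?_
  split_ifs
  · refine Multiset.sum_nonneg fun q hq => ?_
    obtain ⟨r, hr, rfl⟩ := Multiset.mem_map.1 hq
    exact smallSize_nonneg (hP B hB r hr).1
  · exact le_rfl

lemma regularSmallSize_nonneg (hP : ∀ B ∈ P, ∀ v ∈ B, 0 < v ∧ v < 1) :
    0 ≤ regularSmallSize P := by
  refine Multiset.sum_nonneg fun q hq => ?_
  obtain ⟨B, hB, rfl⟩ := Multiset.mem_map.1 hq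
  split_ifs
  · exact le_rfl
  · refine Multiset.sum_nonneg fun q hq => ?_
    obtain ⟨r, hr, rfl⟩ := Multiset.mem_map.1 hq
    exact smallSize_nonneg (hP B hB r hr).1

lemma le_sum_cappedSize (hP : ∀ B ∈ P, ∀ v ∈ B, 0 < v ∧ v < 1) {x : ℚ} (hx : 3/4 ≤ x)
    (hx1 : x ≤ 1) :
    (1 - x) * (P.countP (fun B => IsDeficient B ∧ topSize B ≤ x) + 4 * regularSmallSize P) ≤
      (P.sum.map (cappedSize (1 - x))).sum := by
  unfold regularSmallSize
  induction P using Multiset.induction with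
  | empty => simp
  | cons B P ih =>
    have ih := ih fun B hB => hP B (by simp [hB])
    have hB := hP B (by simp)
    simp only [Multiset.countP_cons, Multiset.map_cons, Multiset.sum_cons, Multiset.map_add,
      Multiset.sum_add]
    have h0 := mul_sum_smallSize_le (d := 1 - x) (by linarith) (by linarith) hB
    have h2 : 0 ≤ (B.map smallSize).sum := Multiset.sum_nonneg fun q hq => by
      obtain ⟨r, hr, rfl⟩ := Multiset.mem_map.1 hq
      exact smallSize_nonneg (hB r hr).1
    by_cases hd : IsDeficient B
    · by_cases ht : topSize B ≤ x
      · have := hd.le_sum_cappedSize hB hx1 ht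
        rw [if_pos ⟨hd, ht⟩, if_pos hd]
        push_cast
        linarith
      · rw [if_neg (fun h => ht h.2), if_pos hd]
        push_cast
        nlinarith
    · rw [if_neg (fun h => hd h.1), if_neg hd]
      push_cast
      linarith

lemma countP_deficient_le (hP : ∀ B ∈ P, ∀ v ∈ B, 0 < v ∧ v < 1) (x : ℚ) :
    P.countP (fun B => IsDeficient B ∧ x ≤ topSize B) ≤ P.sum.countP (x ≤ ·) := by
  induction P using Multiset.induction with
  | empty => simp
  | cons B P ih =>
    have ih := ih fun B hB => hP B (by simp [hB])
    rw [Multiset.countP_cons, Multiset.sum_cons, Multiset.countP_add]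
    split_ifs with h
    · have : 0 < B.countP (x ≤ ·) :=
        Multiset.countP_pos.2 ⟨_, h.1.topSize_mem (hP B (by simp)), h.2⟩
      omega
    · omega

lemma coveredCount_le_card : coveredCount P ≤ P.sum.card := by
  rw [coveredCount, ← Multiset.countP_eq_card_filter]
  induction P using Multiset.induction with
  | empty => simp
  | cons B P ih =>
    rw [Multiset.countP_cons, Multiset.sum_cons, Multiset.card_add]
    split_ifs with h
    · have : 0 < B.card := by
        rw [Multiset.card_pos]
        rintro rfl
        norm_num at h
      omega
    · omega

/-- Some deficient bin has an item of rank `k + 1` among the large items of deficient bins. -/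
lemma exists_threshold (hP : ∀ B ∈ P, ∀ v ∈ B, 0 < v ∧ v < 1) {k : ℕ}
    (hk : k < P.countP IsDeficient) :
    ∃ x : ℚ, 3/4 < x ∧ x < 1 ∧ k + 1 ≤ P.sum.countP (x ≤ ·) ∧
      P.countP IsDeficient ≤ P.countP (fun B => IsDeficient B ∧ topSize B ≤ x) + k := by
  rw [Multiset.countP_eq_card_filter, ← Multiset.card_map topSize] at hk
  obtain ⟨x, hx, h1, h2⟩ := exists_orderStatistic _ hk
  obtain ⟨B, hB, rfl⟩ := Multiset.mem_map.1 hx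
  obtain ⟨hB, hd⟩ := Multiset.mem_filter.1 hB
  refine ⟨_, hd.three_quarters_lt_topSize (hP B hB),
    (hP B hB _ (hd.topSize_mem (hP B hB))).2, ?_, ?_⟩
  · refine le_trans ?_ (countP_deficient_le hP _)
    rw [Multiset.countP_map, Multiset.filter_filter, ← Multiset.countP_eq_card_filter] at h1
    simpa only [and_comm] using h1
  · rw [Multiset.countP_map, Multiset.filter_filter, Multiset.card_map,
      ← Multiset.countP_eq_card_filter, ← Multiset.countP_eq_card_filter] at h2
    simpa only [and_comm] using h2

end Packings

/-- An advice pair for which `DH₄` competes with a given packing. -/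
lemma exists_advice {σ : List ℚ} (hσ : ∀ v ∈ σ, 0 < v ∧ v < 1) {P : Multiset (Multiset ℚ)}
    (hPσ : P.sum = ↑σ) :
    ∃ m ≤ σ.length, ∃ x : ℚ, 1/2 ≤ x ∧ x ≤ 1 ∧
      (2/3 : ℚ) * (coveredCount P : ℚ) - 173/60 ≤ (DH 4 m x σ : ℚ) := by
  classical
  have hP : ∀ B ∈ P, ∀ v ∈ B, 0 < v ∧ v < 1 := by
    intro B hB v hv
    have := Multiset.mem_of_le (Multiset.le_sum_of_mem hB) hv
    rw [hPσ] at this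
    exact hσ v (by simpa using this)
  have hopt := two_thirds_mul_coveredCount_le hP
  have hS := regularSmallSize_le hP
  have hG := regularSmallSize_nonneg hP
  have hcap := fun x => le_sum_cappedSize (x := x) hP
  have hthr := fun k => exists_threshold (k := k) hP
  rw [hPσ] at hopt hS
  simp only [hPσ] at hcap hthr
  generalize regularSmallSize P = G at *
  generalize (coveredCount P : ℚ) = opt at *
  set b := P.countP IsDeficient with hb
  have hb0 : (0 : ℚ) ≤ b := by positivity
  set M : ℚ := b / 3 + 4/3 * G with hM
  have hM0 : 0 ≤ M := by positivity
  have hfloor := Nat.floor_le hM0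
  have hfloor' := Nat.lt_floor_add_one M
  have hlen : ∀ {m : ℕ} {x : ℚ}, m ≤ (σ : Multiset ℚ).countP (x ≤ ·) → m ≤ σ.length := by
    intro m x h
    exact h.trans (by simpa using Multiset.countP_le_card (x ≤ ·) (σ : Multiset ℚ))
  rcases Nat.eq_zero_or_pos (min ⌊M⌋₊ b) with h0 | hpos
  · refine ⟨0, by simp, 1, by norm_num, le_rfl, ?_⟩
    obtain ⟨h1, h2⟩ := le_DH_of_allFilled (m := 0) (by norm_num) le_rfl hσ (by simp)
      (allFilled_zero 1 (by norm_num) le_rfl hσ)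
    rcases Nat.min_eq_zero_iff.1 h0 with h | h
    · rw [h] at hfloor'
      push_cast at *
      linarith
    · rw [h] at hopt hM
      push_cast at *
      linarith
  · obtain ⟨k, hk⟩ : ∃ k, min ⌊M⌋₊ b = k + 1 := ⟨_, (Nat.succ_pred_eq_of_pos hpos).symm⟩
    have hkM : k + 1 ≤ ⌊M⌋₊ := hk ▸ min_le_left _ _
    have hkb : k + 1 ≤ b := hk ▸ min_le_right _ _
    have hkM' : (k : ℚ) + 1 ≤ M := by
      refine le_trans ?_ hfloor
      exact_mod_cast hkM
    obtain ⟨x, hx, hx1, hle, hcnt⟩ := hthr k hkb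
    have hx2 : 1/2 ≤ x := by linarith
    by_cases hf : AllFilled (k + 1) x σ
    · refine ⟨k + 1, hlen hle, x, hx2, hx1.le, ?_⟩
      obtain ⟨h1, h2⟩ := le_DH_of_allFilled hx2 hx1.le hσ hle hf
      rcases min_choice ⌊M⌋₊ b with h | h
      · have : ((k + 1 : ℕ) : ℚ) = ⌊M⌋₊ := by rw [← h, hk]
        linarith
      · have h3 : ((k + 1 : ℕ) : ℚ) = b := by rw [← h, hk]
        push_cast at h1 h2 h3
        rw [h3] at h2 hkM'
        have : (b : ℚ) * (5/4 - x) ≤ b * (1/2) := by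
          apply mul_le_mul_of_nonneg_left _ hb0
          linarith
        linarith
    · obtain ⟨c, hc, hfc, hfc'⟩ : ∃ c ≤ k, AllFilled c x σ ∧ ¬ AllFilled (c + 1) x σ := by
        by_contra! hne
        have : ∀ c ≤ k + 1, AllFilled c x σ := by
          intro c
          induction c with
          | zero => exact fun _ => allFilled_zero x hx2 hx1.le hσ
          | succ c ih => exact fun hc => hne c (by omega) (ih (by omega))
        exact hf (this _ le_rfl)
      have hle' : c ≤ (σ : Multiset ℚ).countP (x ≤ ·) := by omega
      refine ⟨c, hlen hle', x, hx2, hx1.le, ?_⟩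
      obtain ⟨h1, -⟩ := le_DH_of_allFilled hx2 hx1.le hσ hle' hfc
      have h2 := sum_cappedSize_le_of_not_allFilled hx2 hx1.le hσ hfc'
      have h3 := le_of_mul_le_mul_left ((hcap x hx.le hx1.le).trans h2) (by linarith)
      have h4 : (b : ℚ) ≤ P.countP (fun B => IsDeficient B ∧ topSize B ≤ x) + k := by
        exact_mod_cast hcnt
      push_cast at h3
      linarith

/-- For every finite list `σ` of rational items in `(0,1)` there is advice
`m ≤ |σ|` and `x ∈ [1/2, 1]` such that `DH₄` with advice `(m, x)` covers at
least `(2/3)·OPT(σ) − 173/60` bins, where the optimum ranges over all partitions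
of the multiset of items of `σ` into bins. -/
theorem dh4_two_thirds (σ : List ℚ) (hσ : ∀ v ∈ σ, 0 < v ∧ v < 1) :
    ∃ m ≤ σ.length, ∃ x : ℚ, 1/2 ≤ x ∧ x ≤ 1 ∧
      ∀ P : Multiset (Multiset ℚ), P.sum = ↑σ →
        (2/3 : ℚ) * (coveredCount P : ℚ) - 173/60 ≤ (DH 4 m x σ : ℚ) := by
  obtain ⟨P, hP, hmax⟩ : ∃ P : Multiset (Multiset ℚ), P.sum = ↑σ ∧
      ∀ Q : Multiset (Multiset ℚ), Q.sum = ↑σ → coveredCount Q ≤ coveredCount P := by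
    have hle : ∀ Q : Multiset (Multiset ℚ), Q.sum = ↑σ → coveredCount Q ≤ σ.length := by
      intro Q hQ
      have := coveredCount_le_card (P := Q)
      rwa [hQ, Multiset.coe_card] at this
    obtain ⟨P, hP, hmin⟩ := (measure fun Q => σ.length - coveredCount Q).wf.has_min
      {Q : Multiset (Multiset ℚ) | Q.sum = ↑σ} ⟨{↑σ}, Multiset.sum_singleton _⟩
    refine ⟨P, hP, fun Q hQ => ?_⟩
    have h1 : ¬ σ.length - coveredCount Q < σ.length - coveredCount P := hmin Q hQ
    have h2 := hle Q hQ
    omega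
  obtain ⟨m, hm, x, hx, hx1, h⟩ := exists_advice hσ hP
  refine ⟨m, hm, x, hx, hx1, fun Q hQ => le_trans ?_ h⟩
  have : (coveredCount Q : ℚ) ≤ coveredCount P := by exact_mod_cast hmax Q hQ
  linarith
end
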